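/- arXiv:2207.04238 — 14 statements merged into one kernel-verified Lean document; each statement's English description precedes it below -/
import Mathlib

section
/- For the At-Most-Single-Neighbor pattern, every finite simple graph with at least one vertex admits a non-trivial pure Nash equilibrium of the associated public goods game. -/
/-- `u` plays a best response under profile `s` for pattern `T` on graph `G`:
its strategy equals `T` applied to the number of its neighbors playing 1. -/
def BestResponds {V : Type*} [Fintype V] (G : SimpleGraph V) (T : ℕ → Bool)
    (s : V → Bool) (u : V) : Prop :=
  s u = T (Set.ncard {w : V | G.Adj u w ∧ s w = true})

/-- `s` is a pure Nash equilibrium for pattern `T` on `G`. -/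
def IsPNE {V : Type*} [Fintype V] (G : SimpleGraph V) (T : ℕ → Bool) (s : V → Bool) : Prop :=
  ∀ v : V, BestResponds G T s v

/-- `s` is a non-trivial pure Nash equilibrium for pattern `T` on `G`. -/
def IsNTPNE {V : Type*} [Fintype V] (G : SimpleGraph V) (T : ℕ → Bool) (s : V → Bool) : Prop :=
  IsPNE G T s ∧ ∃ v, s v = true

/-- The Single-Neighbor pattern: best response is 1 iff exactly one neighbor plays 1. -/
def SN : ℕ → Bool := fun k => decide (k = 1)

/-- The At-Most-Single-Neighbor pattern: best response is 1 iff at most one neighbor plays 1. -/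
def AMSN : ℕ → Bool := fun k => decide (k ≤ 1)

open Classical in
/-- Three times the number of vertices of `S` minus twice the number of edges inside `S`. -/
noncomputable def amsnPotential {V : Type*} (G : SimpleGraph V) (S : Finset V) : ℤ :=
  3 * S.card - ∑ u ∈ S, ∑ w ∈ S, if G.Adj u w then 1 else 0

open Classical in
theorem amsnPotential_insert {V : Type*} (G : SimpleGraph V) {S : Finset V} {v : V}
    (hv : v ∉ S) :
    amsnPotential G (insert v S) =
      amsnPotential G S + 3 - 2 * ((S.filter (G.Adj v)).card : ℤ) := by
  have h_degree : ((S.filter (G.Adj v)).card : ℤ) = ∑ w ∈ S, if G.Adj v w then 1 else 0 := by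
    simp
  simp only [amsnPotential, Finset.card_insert_of_notMem hv, Finset.sum_insert hv,
    Finset.sum_add_distrib, h_degree, G.irrefl, G.adj_comm _ v, if_false]
  push_cast
  ring

/-- For the At-Most-Single-Neighbor pattern, every finite simple graph with at
least one vertex admits a non-trivial pure Nash equilibrium. -/
theorem amsn_ntpne_exists {V : Type*} [Fintype V] [Nonempty V]
    (G : SimpleGraph V) :
    ∃ s : V → Bool, IsNTPNE G AMSN s := by
  classical
  obtain ⟨S, hS⟩ := Finite.exists_max (amsnPotential G)
  have h_count (v : V) :
      Set.ncard {w : V | G.Adj v w ∧ decide (w ∈ S) = true} = (S.filter (G.Adj v)).card := by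
    rw [← Set.ncard_coe_finset]
    congr 1
    ext w
    simp [and_comm]
  have h_pne : IsPNE G AMSN fun v => decide (v ∈ S) := by
    intro v
    simp only [BestResponds, AMSN, h_count, decide_eq_decide]
    by_cases hv : v ∈ S
    · have h_insert := amsnPotential_insert G (Finset.notMem_erase v S)
      have h_max := hS (S.erase v)
      have h_filter : (S.erase v).filter (G.Adj v) = S.filter (G.Adj v) := by
        ext w
        simp only [Finset.mem_filter, Finset.mem_erase]
        exact ⟨fun h => ⟨h.1.2, h.2⟩, fun h => ⟨⟨h.2.ne', h.1⟩, h.2⟩⟩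
      rw [Finset.insert_erase hv, h_filter] at h_insert
      simp only [hv, true_iff]
      omega
    · have h_insert := amsnPotential_insert G hv
      have h_max := hS (insert v S)
      simp only [hv, false_iff]
      omega
  refine ⟨_, h_pne, ?_⟩
  by_contra! h_trivial
  obtain ⟨v⟩ := ‹Nonempty V›
  have h_best := h_pne v
  simp_all [BestResponds, AMSN]
end

section
/- Let G be a finite simple graph and let S be a maximum independent set of G (an independent set of largest cardinality). Then there exists a non-trivial pure Nash equilibrium s of the public goods game on G for the At-Most-Single-Neighbor pattern such that s(v) = 1 for every v ∈ S. -/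
/-- Every vertex outside a maximum independent set has a neighbor in it. -/
theorem exists_adj_of_maximum_independent {V : Type*} (G : SimpleGraph V) (S : Finset V)
    (hind : ∀ u ∈ S, ∀ w ∈ S, ¬ G.Adj u w)
    (hmax : ∀ S' : Finset V, (∀ u ∈ S', ∀ w ∈ S', ¬ G.Adj u w) → S'.card ≤ S.card)
    {v : V} (hv : v ∉ S) : ∃ u ∈ S, G.Adj v u := by
  classical
  by_contra! h
  have hcard := hmax (insert v S) (by
    intro a ha b hb hab
    grind [hab.symm, G.loopless.irrefl v])
  rw [Finset.card_insert_of_notMem hv] at hcard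
  omega

/-- A maximum independent set extends to a set `D` inducing a subgraph of maximum degree at
most one, such that every vertex outside `D` has two distinct neighbors in `D`. -/
theorem exists_superset_of_maximum_independent {V : Type*} [Finite V]
    (G : SimpleGraph V) (S : Finset V)
    (hind : ∀ u ∈ S, ∀ w ∈ S, ¬ G.Adj u w)
    (hmax : ∀ S' : Finset V, (∀ u ∈ S', ∀ w ∈ S', ¬ G.Adj u w) → S'.card ≤ S.card) :
    ∃ D : Finset V, S ⊆ D ∧
      ∀ v, v ∈ D ↔ ∀ a ∈ D, ∀ b ∈ D, G.Adj v a → G.Adj v b → a = b := by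
  classical
  obtain ⟨D, hSD, hD⟩ := (Set.toFinite {D : Finset V |
    ∀ u ∈ D, ∀ a ∈ D, ∀ b ∈ D, G.Adj u a → G.Adj u b → a = b}).exists_le_maximal
    (a := S) (fun u hu a ha _ _ hua => (hind u hu a ha hua).elim)
  have hdeg : ∀ u ∈ D, ∀ a ∈ D, ∀ b ∈ D, G.Adj u a → G.Adj u b → a = b := hD.prop
  refine ⟨D, hSD, fun v => ⟨hdeg v, fun hone => ?_⟩⟩
  by_contra hv
  have hvS : v ∉ S := fun h => hv (hSD h)
  obtain ⟨u, huS, hvu⟩ := exists_adj_of_maximum_independent G S hind hmax hvS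
  have honly : ∀ a ∈ D, G.Adj v a → a = u := fun a ha hva => hone a ha u (hSD huS) hva hvu
  have hx : ∃ x ∈ D, G.Adj u x := by
    by_contra! hno
    refine hv (hD.le_of_ge (y := insert v D) ?_ (Finset.subset_insert v D)
      (Finset.mem_insert_self v D))
    intro w hw a ha b hb hwa hwb
    have hirr := G.loopless.irrefl v
    have hwa' := hwa.symm
    have hwb' := hwb.symm
    grind
  obtain ⟨x, hxD, hux⟩ := hx
  have hxS : x ∉ S := fun h => hind u huS x h hux
  have hxonly : ∀ a ∈ D, G.Adj x a → a = u :=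
    fun a ha hxa => hdeg x hxD a ha u (hSD huS) hxa hux.symm
  have hcard := hmax (insert v (insert x (S.erase u))) (by
    intro a ha b hb hab
    have hab' := hab.symm
    have hne := hab.ne
    have hxu := hux.ne
    have hmem : ∀ c ∈ S, c ∈ D := fun c hc => hSD hc
    grind)
  have hxv : v ≠ x := fun h => hv (h ▸ hxD)
  rw [Finset.card_insert_of_notMem (by simp [hxv, hvS]),
    Finset.card_insert_of_notMem (by simp [hxS]), Finset.card_erase_add_one huS] at hcard
  omega

/-- If `S` is a maximum independent set of `G`, then there is a non-trivial pure
Nash equilibrium of the At-Most-Single-Neighbor public goods game on `G` in which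
every vertex of `S` plays 1. -/
theorem amsn_ntpne_of_maximum_independent_set {V : Type*} [Fintype V] [Nonempty V]
    (G : SimpleGraph V) (S : Finset V)
    (hind : ∀ u ∈ S, ∀ w ∈ S, ¬ G.Adj u w)
    (hmax : ∀ S' : Finset V, (∀ u ∈ S', ∀ w ∈ S', ¬ G.Adj u w) → S'.card ≤ S.card) :
    ∃ s : V → Bool, IsNTPNE G AMSN s ∧ ∀ v ∈ S, s v = true := by
  classical
  obtain ⟨D, hSD, hD⟩ := exists_superset_of_maximum_independent G S hind hmax
  refine ⟨fun v => decide (v ∈ D), ⟨fun v => ?_, ?_⟩, fun v hv => by simpa using hSD hv⟩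
  · simp only [BestResponds, AMSN, decide_eq_true_eq, decide_eq_decide]
    rw [Set.ncard_le_one, hD v]
    exact ⟨fun h a ha b hb => h a ha.2 b hb.2 ha.1 hb.1,
      fun h a ha b hb hva hvb => h a ⟨hva, ha⟩ b ⟨hvb, hb⟩⟩
  · obtain ⟨v⟩ := ‹Nonempty V›
    by_cases hv : v ∈ S
    · exact ⟨v, by simpa using hSD hv⟩
    · obtain ⟨u, hu, -⟩ := exists_adj_of_maximum_independent G S hind hmax hv
      exact ⟨u, by simpa using hSD hu⟩
end

section
/- In any pure Nash equilibrium for the Single-Neighbor pattern of a graph G containing a clause gadget, if some vertex of the clause gadget plays 1, then at least one of the three literal nodes plays 1. -/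
/-- A clause gadget in `G` on nine distinct vertices: literal nodes `l₁ l₂ l₃`,
inner nodes `a b c`, peripheral nodes `x y z`.  The exact neighborhoods of the
inner and peripheral nodes are specified (they have no neighbors outside the
gadget); the literal nodes are pairwise adjacent and may have further neighbors. -/
structure ClauseGadget {V : Type*} (G : SimpleGraph V)
    (l₁ l₂ l₃ a b c x y z : V) : Prop where
  distinct : [l₁, l₂, l₃, a, b, c, x, y, z].Pairwise (· ≠ ·)
  adj_l₁l₂ : G.Adj l₁ l₂
  adj_l₁l₃ : G.Adj l₁ l₃
  adj_l₂l₃ : G.Adj l₂ l₃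
  nbhd_a : G.neighborSet a = {b, c, l₁, x}
  nbhd_b : G.neighborSet b = {a, c, l₂, y}
  nbhd_c : G.neighborSet c = {a, b, l₃, z}
  nbhd_x : G.neighborSet x = {a, l₁, l₂, l₃}
  nbhd_y : G.neighborSet y = {b, l₁, l₂, l₃}
  nbhd_z : G.neighborSet z = {c, l₁, l₂, l₃}

theorem IsPNE.eq_true_iff_existsUnique {V : Type*} [Fintype V] {G : SimpleGraph V}
    {s : V → Bool} (hs : IsPNE G SN s) (v : V) :
    s v = true ↔ ∃! w, w ∈ G.neighborSet v ∧ s w = true := by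
  rw [hs v, SN, decide_eq_true_iff, Set.ncard_eq_one]
  simp only [Set.eq_singleton_iff_unique_mem, ExistsUnique, Set.mem_ofPred_eq,
    SimpleGraph.mem_neighborSet]

/-- A vertex whose last three neighbors play 0 copies its first neighbor. -/
theorem IsPNE.eq_of_neighborSet_eq {V : Type*} [Fintype V] {G : SimpleGraph V}
    {s : V → Bool} (hs : IsPNE G SN s) {v p q r t : V} (hv : G.neighborSet v = {p, q, r, t})
    (hq : s q = false) (hr : s r = false) (ht : s t = false) : s v = s p := by
  have h := hs.eq_true_iff_existsUnique v
  simp only [hv, ExistsUnique, Set.mem_insert_iff, Set.mem_singleton_iff] at h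
  rw [Bool.eq_iff_iff, h]
  grind

/-- With the literal nodes playing 0, an inner node playing 1 would have its peripheral node as
only neighbor playing 1, so that another inner node would have a unique neighbor playing 1. -/
theorem IsPNE.inner_eq_false {V : Type*} [Fintype V] {G : SimpleGraph V}
    {s : V → Bool} (hs : IsPNE G SN s) {a b c l m x y : V}
    (ha : G.neighborSet a = {b, c, l, x}) (hb : G.neighborSet b = {a, c, m, y})
    (hxb : x ≠ b) (hxc : x ≠ c) (hx : s x = s a) (hy : s y = s b) (hm : s m = false) :
    s a = false := by
  have h₁ := hs.eq_true_iff_existsUnique a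
  have h₂ := hs.eq_true_iff_existsUnique b
  simp only [ha, hb, ExistsUnique, Set.mem_insert_iff, Set.mem_singleton_iff] at h₁ h₂
  grind

/-- In any PNE for the Single-Neighbor pattern, if some vertex of a clause
gadget plays 1, then at least one of the three literal nodes plays 1. -/
theorem clauseGadget_literal_plays_one {V : Type*} [Fintype V] (G : SimpleGraph V)
    (l₁ l₂ l₃ a b c x y z : V) (hg : ClauseGadget G l₁ l₂ l₃ a b c x y z)
    (s : V → Bool) (hs : IsPNE G SN s)
    (hone : s l₁ = true ∨ s l₂ = true ∨ s l₃ = true ∨ s a = true ∨ s b = true ∨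
      s c = true ∨ s x = true ∨ s y = true ∨ s z = true) :
    s l₁ = true ∨ s l₂ = true ∨ s l₃ = true := by
  by_contra! h
  simp only [ne_eq, Bool.not_eq_true] at h
  obtain ⟨h₁, h₂, h₃⟩ := h
  have hx := hs.eq_of_neighborSet_eq hg.nbhd_x h₁ h₂ h₃
  have hy := hs.eq_of_neighborSet_eq hg.nbhd_y h₁ h₂ h₃
  have hz := hs.eq_of_neighborSet_eq hg.nbhd_z h₁ h₂ h₃
  have hd := hg.distinct
  simp only [List.pairwise_cons, List.mem_cons, forall_eq_or_imp] at hd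
  have ha : s a = false :=
    hs.inner_eq_false hg.nbhd_a hg.nbhd_b (by grind) (by grind) hx hy h₂
  have hb : s b = false :=
    hs.inner_eq_false hg.nbhd_b hg.nbhd_a (by grind) (by grind) hy hx h₁
  have hc : s c = false :=
    hs.inner_eq_false hg.nbhd_c (hg.nbhd_a.trans (Set.insert_comm _ _ _))
      (by grind) (by grind) hz hx h₁
  simp_all
end

section
/- In any pure Nash equilibrium for the Single-Neighbor pattern of a graph G containing a clause gadget, if one of the literal nodes of the gadget plays 1, then the other two literal nodes play 0. -/
/-- In a PNE for the Single-Neighbor pattern, a vertex with exactly four neighbors plays 1 iff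
exactly one of them does. -/
theorem IsPNE.eq_decide_of_neighborSet_eq {V : Type*} [Fintype V] {G : SimpleGraph V}
    {s : V → Bool} (hs : IsPNE G SN s) {u p q r t : V} (hu : G.neighborSet u = {p, q, r, t})
    (hd : [p, q, r, t].Nodup) :
    s u = decide ((s p).toNat + (s q).toNat + (s r).toNat + (s t).toNat = 1) := by
  classical
  have hset : {w : V | G.Adj u w ∧ s w = true} =
      (({p, q, r, t} : Finset V).filter (fun w => s w = true) : Set V) := by
    ext w
    have hw : G.Adj u w ↔ w ∈ ({p, q, r, t} : Set V) := by
      rw [← hu, SimpleGraph.mem_neighborSet]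
    simp [hw]
  have key := hs u
  simp only [List.nodup_cons, List.mem_cons, List.not_mem_nil, or_false, not_or] at hd
  rw [BestResponds, hset, Set.ncard_coe_finset, Finset.card_filter,
    Finset.sum_insert (by simp [hd]), Finset.sum_insert (by simp [hd]),
    Finset.sum_insert (by simp [hd]), Finset.sum_singleton] at key
  rw [key, SN]
  cases s p <;> cases s q <;> cases s r <;> cases s t <;> rfl

/-- In a PNE for the Single-Neighbor pattern, a vertex with two distinct neighbors playing 1
plays 0. -/
theorem IsPNE.eq_false_of_adj_of_adj {V : Type*} [Fintype V] {G : SimpleGraph V}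
    {s : V → Bool} (hs : IsPNE G SN s) {u p q : V} (hup : G.Adj u p) (huq : G.Adj u q)
    (hpq : p ≠ q) (hp : s p = true) (hq : s q = true) : s u = false := by
  rw [hs u, SN, decide_eq_false_iff_not, Set.ncard_eq_one]
  rintro ⟨w, hw⟩
  have hpw : p ∈ ({w} : Set V) := hw ▸ ⟨hup, hp⟩
  have hqw : q ∈ ({w} : Set V) := hw ▸ ⟨huq, hq⟩
  exact hpq (hpw.trans hqw.symm)

/-- In any PNE for the Single-Neighbor pattern, if one literal node of a clause
gadget plays 1, then the other two literal nodes play 0. -/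
theorem clauseGadget_one_literal {V : Type*} [Fintype V] (G : SimpleGraph V)
    (l₁ l₂ l₃ a b c x y z : V) (hg : ClauseGadget G l₁ l₂ l₃ a b c x y z)
    (s : V → Bool) (hs : IsPNE G SN s) :
    (s l₁ = true → s l₂ = false ∧ s l₃ = false) ∧
    (s l₂ = true → s l₁ = false ∧ s l₃ = false) ∧
    (s l₃ = true → s l₁ = false ∧ s l₂ = false) := by
  have hd := hg.distinct
  simp only [List.pairwise_cons, List.mem_cons, List.not_mem_nil, or_false, forall_eq_or_imp,
    forall_eq] at hd
  have ha := hs.eq_decide_of_neighborSet_eq hg.nbhd_a (by grind)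
  have hb := hs.eq_decide_of_neighborSet_eq hg.nbhd_b (by grind)
  have hc := hs.eq_decide_of_neighborSet_eq hg.nbhd_c (by grind)
  have hx := hs.eq_decide_of_neighborSet_eq hg.nbhd_x (by grind)
  have hy := hs.eq_decide_of_neighborSet_eq hg.nbhd_y (by grind)
  have hz := hs.eq_decide_of_neighborSet_eq hg.nbhd_z (by grind)
  have hl := hs.eq_false_of_adj_of_adj hg.adj_l₁l₂ hg.adj_l₁l₃ hg.adj_l₂l₃.ne
  clear hd hg hs
  generalize s l₁ = l₁, s l₂ = l₂, s l₃ = l₃, s a = a, s b = b, s c = c,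
    s x = x, s y = y, s z = z at *
  revert l₁ l₂ l₃ a b c x y z
  decide
end

section
/- In any pure Nash equilibrium for the Single-Neighbor pattern of a graph G containing a clause gadget, if one of the literal nodes of the gadget plays 1, then its paired peripheral node also plays 1. -/
/-- The clause gadget is symmetric under rotating its three indices. -/
theorem ClauseGadget.rotate {V : Type*} {G : SimpleGraph V} {l₁ l₂ l₃ a b c x y z : V}
    (hg : ClauseGadget G l₁ l₂ l₃ a b c x y z) : ClauseGadget G l₂ l₃ l₁ b c a y z x where
  distinct := by
    have := hg.distinct
    simp only [List.pairwise_cons, List.mem_cons, List.not_mem_nil] at this ⊢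
    grind
  adj_l₁l₂ := hg.adj_l₂l₃
  adj_l₁l₃ := hg.adj_l₁l₂.symm
  adj_l₂l₃ := hg.adj_l₁l₃.symm
  nbhd_a := by rw [hg.nbhd_b, Set.insert_comm]
  nbhd_b := by rw [hg.nbhd_c, Set.insert_comm]
  nbhd_c := hg.nbhd_a
  nbhd_x := by rw [hg.nbhd_y]; grind
  nbhd_y := by rw [hg.nbhd_z]; grind
  nbhd_z := by rw [hg.nbhd_x]; grind

namespace IsPNE

variable {V : Type*} [Fintype V] {G : SimpleGraph V} {s : V → Bool}

/-- In an equilibrium for `SN`, a vertex plays 1 iff exactly one neighbor plays 1. -/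
theorem eq_true_iff (hs : IsPNE G SN s) (u : V) :
    s u = true ↔ ∃ w, G.Adj u w ∧ s w = true ∧ ∀ v, G.Adj u v → s v = true → v = w := by
  rw [hs u, SN, decide_eq_true_iff, Set.ncard_eq_one]
  refine exists_congr fun w => ?_
  rw [Set.eq_singleton_iff_unique_mem]
  simp [and_assoc]

/-- Two neighbors playing 1 of a vertex playing 1 in an equilibrium for `SN` coincide. -/
theorem eq_of_adj (hs : IsPNE G SN s) {u v w : V} (hu : s u = true) (hv : G.Adj u v)
    (hw : G.Adj u w) (hsv : s v = true) (hsw : s w = true) : v = w := by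
  obtain ⟨t, -, -, ht⟩ := (hs.eq_true_iff u).1 hu
  rw [ht v hv hsv, ht w hw hsw]

/-- A vertex of degree four in an equilibrium for `SN`, in terms of its neighbors. -/
theorem eq_true_iff_of_neighborSet (hs : IsPNE G SN s) {u p q r t : V}
    (h : G.neighborSet u = {p, q, r, t}) (hd : [p, q, r, t].Pairwise (· ≠ ·)) :
    s u = true ↔ (s p).toNat + (s q).toNat + (s r).toNat + (s t).toNat = 1 := by
  have hadj : ∀ w, G.Adj u w ↔ w = p ∨ w = q ∨ w = r ∨ w = t := fun w => by
    rw [← SimpleGraph.mem_neighborSet, h]; rfl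
  simp only [List.pairwise_cons, List.mem_cons, List.not_mem_nil] at hd
  rw [hs.eq_true_iff]
  simp only [hadj, or_and_right, exists_or, exists_eq_left, or_imp, forall_and, forall_eq]
  cases hp : s p <;> cases hq : s q <;> cases hr : s r <;> cases ht : s t <;> simp <;> grind

end IsPNE

/-- In an equilibrium for `SN`, if the first literal node of a clause gadget plays 1, then so
does its paired peripheral node. -/
theorem ClauseGadget.paired_peripheral_of_literal {V : Type*} [Fintype V] {G : SimpleGraph V}
    {l₁ l₂ l₃ a b c x y z : V} (hg : ClauseGadget G l₁ l₂ l₃ a b c x y z)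
    {s : V → Bool} (hs : IsPNE G SN s) (hl : s l₁ = true) : s x = true := by
  obtain ⟨hd, h12, h13, -, na, nb, nc, nx, ny, nz⟩ := hg
  simp only [List.pairwise_cons, List.mem_cons, List.not_mem_nil] at hd
  have adj {u v : V} {S : Set V} (h : G.neighborSet u = S) (hv : v ∈ S) : G.Adj v u := by
    rwa [← h, SimpleGraph.mem_neighborSet, SimpleGraph.adj_comm] at hv
  have la : G.Adj l₁ a := adj na (by simp)
  have ly : G.Adj l₁ y := adj ny (by simp)
  have lz : G.Adj l₁ z := adj nz (by simp)
  have l2b : G.Adj l₂ b := adj nb (by simp)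
  have l3c : G.Adj l₃ c := adj nc (by simp)
  have ea := hs.eq_true_iff_of_neighborSet na (by simp; grind)
  have eb := hs.eq_true_iff_of_neighborSet nb (by simp; grind)
  have ec := hs.eq_true_iff_of_neighborSet nc (by simp; grind)
  have ex := hs.eq_true_iff_of_neighborSet nx (by simp; grind)
  have ey := hs.eq_true_iff_of_neighborSet ny (by simp; grind)
  have only : ∀ {u v}, G.Adj l₁ u → G.Adj l₁ v → u ≠ v → s u = true → s v = false :=
    fun hu hv hne hsu => by
      by_contra hsv
      exact hne (hs.eq_of_adj hl hu hv hsu (by simpa using hsv))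
  by_contra hx
  rw [Bool.not_eq_true] at hx
  cases ha : s a
  · cases h2 : s l₂
    · cases h3 : s l₃
      · simp_all
      · have hy := only h13 ly (by grind) h3
        have hc : s c = false := by
          by_contra hc
          exact absurd (hs.eq_of_adj h3 h13.symm l3c hl (by simpa using hc)) (by grind)
        simp_all
    · have h3 := only h12 h13 (by grind) h2
      have hz := only h12 lz (by grind) h2
      have hb : s b = false := by
        by_contra hb
        exact absurd (hs.eq_of_adj h2 h12.symm l2b hl (by simpa using hb)) (by grind)
      simp_all
  · have h2 := only la h12 (by grind) ha
    have h3 := only la h13 (by grind) ha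
    have hy := only la ly (by grind) ha
    have hb : s b = false := by
      cases hb : s b
      · rfl
      · simp_all
    simp_all

/-- In any PNE for the Single-Neighbor pattern, if a literal node of a clause
gadget plays 1, then so does its paired peripheral node. -/
theorem clauseGadget_paired_peripheral {V : Type*} [Fintype V] (G : SimpleGraph V)
    (l₁ l₂ l₃ a b c x y z : V) (hg : ClauseGadget G l₁ l₂ l₃ a b c x y z)
    (s : V → Bool) (hs : IsPNE G SN s) :
    (s l₁ = true → s x = true) ∧
    (s l₂ = true → s y = true) ∧
    (s l₃ = true → s z = true) := by
  exact ⟨hg.paired_peripheral_of_literal hs, hg.rotate.paired_peripheral_of_literal hs,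
    hg.rotate.rotate.paired_peripheral_of_literal hs⟩
end

section
/- In any pure Nash equilibrium for the Single-Neighbor pattern of a graph G containing a clause gadget, if some vertex of the clause gadget plays 1, then the assignment on the gadget is uniquely determined up to the choice of one literal node: exactly one literal node plays 1, its paired peripheral node plays 1, the two inner nodes not adjacent to that literal node play 1, and the remaining five gadget vertices play 0. (For instance, if l1 plays 1 then x, b, c play 1 and l2, l3, a, y, z play 0.) -/
section SingleNeighbor

variable {V : Type*} [Fintype V] {G : SimpleGraph V} {s : V → Bool} {v : V}

theorem BestResponds.eq_true_iff_existsUnique (h : BestResponds G SN s v) :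
    s v = true ↔ ∃! w, G.Adj v w ∧ s w = true := by
  rw [h, SN, decide_eq_true_iff, Set.ncard_eq_one]
  simp only [Set.eq_singleton_iff_unique_mem]
  rfl

/-- A vertex playing 1 has at most one neighbor playing 1. -/
theorem BestResponds.sum_toNat_le_one (h : BestResponds G SN s v) (hv : s v = true)
    {L : List V} (hL : L.Nodup) (hadj : ∀ w ∈ L, G.Adj v w) :
    (L.map fun w => (s w).toNat).sum ≤ 1 := by
  obtain ⟨u, -, hu⟩ := h.eq_true_iff_existsUnique.1 hv
  induction L with
  | nil => simp
  | cons p L ih =>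
    simp only [List.nodup_cons, List.forall_mem_cons] at hL hadj
    rw [List.map_cons, List.sum_cons]
    cases hp : s p
    · simpa using ih hL.2 hadj.2
    · have hzero : ∀ n ∈ L.map fun w => (s w).toNat, n = 0 := by
        simp only [List.forall_mem_map, Bool.toNat_eq_zero]
        intro w hw
        by_contra hsw
        have hpw := (hu p ⟨hadj.1, hp⟩).trans
          (hu w ⟨hadj.2 w hw, by simpa using hsw⟩).symm
        exact hL.1 (hpw ▸ hw)
      simp [List.sum_eq_zero hzero]

/-- The best response of a vertex with four distinct neighbors. -/
theorem BestResponds.toNat_eq_one_iff (h : BestResponds G SN s v) {p q r t : V}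
    (hN : G.neighborSet v = {p, q, r, t}) (hd : [p, q, r, t].Nodup) :
    (s v).toNat = 1 ↔ (s p).toNat + (s q).toNat + (s r).toNat + (s t).toNat = 1 := by
  have hadj : ∀ w, G.Adj v w ↔ w = p ∨ w = q ∨ w = r ∨ w = t := fun w => by
    simpa using Set.ext_iff.1 hN w
  rw [Bool.toNat_eq_one, h.eq_true_iff_existsUnique]
  simp only [hadj, ExistsUnique]
  simp only [List.nodup_cons, List.mem_cons, List.not_mem_nil] at hd
  cases hp : s p <;> cases hq : s q <;> cases hr : s r <;> cases ht : s t <;>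
    simp only [Bool.toNat_true, Bool.toNat_false] <;> grind

end SingleNeighbor

namespace ClauseGadget

variable {V : Type*} {G : SimpleGraph V} {l₁ l₂ l₃ a b c x y z : V}

theorem nodup (hg : ClauseGadget G l₁ l₂ l₃ a b c x y z) :
    [l₁, l₂, l₃, a, b, c, x, y, z].Nodup :=
  hg.distinct

theorem rotate_s5 (hg : ClauseGadget G l₁ l₂ l₃ a b c x y z) :
    ClauseGadget G l₂ l₃ l₁ b c a y z x where
  distinct := by
    have := hg.distinct
    grind
  adj_l₁l₂ := hg.adj_l₂l₃
  adj_l₁l₃ := hg.adj_l₁l₂.symm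
  adj_l₂l₃ := hg.adj_l₁l₃.symm
  nbhd_a := hg.nbhd_b.trans (by grind)
  nbhd_b := hg.nbhd_c.trans (by grind)
  nbhd_c := hg.nbhd_a.trans (by grind)
  nbhd_x := hg.nbhd_y.trans (by grind)
  nbhd_y := hg.nbhd_z.trans (by grind)
  nbhd_z := hg.nbhd_x.trans (by grind)

theorem adj_literal (hg : ClauseGadget G l₁ l₂ l₃ a b c x y z) :
    ∀ w ∈ [l₂, l₃, a, x, y, z], G.Adj l₁ w := by
  have mem_symm {w : V} (h : l₁ ∈ G.neighborSet w) : G.Adj l₁ w := h.symm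
  simp [hg.adj_l₁l₂, hg.adj_l₁l₃, mem_symm, hg.nbhd_a, hg.nbhd_x, hg.nbhd_y, hg.nbhd_z]

variable [Fintype V] {s : V → Bool}

theorem literal_le_one (hg : ClauseGadget G l₁ l₂ l₃ a b c x y z) (hs : IsPNE G SN s)
    (h : (s l₁).toNat = 1) :
    (s l₂).toNat + (s l₃).toNat + (s a).toNat + (s x).toNat + (s y).toNat + (s z).toNat ≤ 1 := by
  have hd := hg.nodup
  simpa [add_assoc] using (hs l₁).sum_toNat_le_one (Bool.toNat_eq_one.1 h)
    (by grind : [l₂, l₃, a, x, y, z].Nodup) hg.adj_literal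

theorem inner_iff_and_peripheral_iff (hg : ClauseGadget G l₁ l₂ l₃ a b c x y z)
    (hs : IsPNE G SN s) :
    ((s a).toNat = 1 ↔ (s b).toNat + (s c).toNat + (s l₁).toNat + (s x).toNat = 1) ∧
    ((s x).toNat = 1 ↔ (s a).toNat + (s l₁).toNat + (s l₂).toNat + (s l₃).toNat = 1) := by
  have hd := hg.nodup
  exact ⟨(hs a).toNat_eq_one_iff hg.nbhd_a (by grind),
    (hs x).toNat_eq_one_iff hg.nbhd_x (by grind)⟩

/-- A literal node playing 1 determines the assignment on the gadget. -/
theorem eq_of_literal (hg : ClauseGadget G l₁ l₂ l₃ a b c x y z) (hs : IsPNE G SN s)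
    (h : s l₁ = true) :
    s x = true ∧ s b = true ∧ s c = true ∧
      s l₂ = false ∧ s l₃ = false ∧ s a = false ∧ s y = false ∧ s z = false := by
  obtain ⟨ha, hx⟩ := hg.inner_iff_and_peripheral_iff hs
  obtain ⟨hb, hy⟩ := hg.rotate_s5.inner_iff_and_peripheral_iff hs
  obtain ⟨hc, hz⟩ := hg.rotate_s5.rotate_s5.inner_iff_and_peripheral_iff hs
  have h₁ := hg.literal_le_one hs
  have h₂ := hg.rotate_s5.literal_le_one hs
  have h₃ := hg.rotate_s5.rotate_s5.literal_le_one hs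
  cases e₂ : s l₂ <;> cases e₃ : s l₃ <;> cases ea : s a <;> cases ex : s x <;>
    simp [h, e₂, e₃, ea, ex] at * <;> grind

/-- Without a literal node playing 1, the whole gadget plays 0. -/
theorem eq_false_of_literals (hg : ClauseGadget G l₁ l₂ l₃ a b c x y z) (hs : IsPNE G SN s)
    (e₁ : s l₁ = false) (e₂ : s l₂ = false) (e₃ : s l₃ = false) :
    s a = false ∧ s b = false ∧ s c = false ∧ s x = false ∧ s y = false ∧ s z = false := by
  obtain ⟨ha, hx⟩ := hg.inner_iff_and_peripheral_iff hs
  obtain ⟨hb, hy⟩ := hg.rotate_s5.inner_iff_and_peripheral_iff hs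
  obtain ⟨hc, hz⟩ := hg.rotate_s5.rotate_s5.inner_iff_and_peripheral_iff hs
  cases ea : s a <;> cases eb : s b <;> cases ec : s c <;>
    simp_all

end ClauseGadget

/-- In any PNE for the Single-Neighbor pattern, if some vertex of a clause gadget
plays 1, then the assignment on the gadget is one of three: one literal node and
its paired peripheral node play 1, the two inner nodes not adjacent to that
literal node play 1, and the remaining five gadget vertices play 0. -/
theorem clauseGadget_unique_assignment {V : Type*} [Fintype V] (G : SimpleGraph V)
    (l₁ l₂ l₃ a b c x y z : V) (hg : ClauseGadget G l₁ l₂ l₃ a b c x y z)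
    (s : V → Bool) (hs : IsPNE G SN s)
    (hone : s l₁ = true ∨ s l₂ = true ∨ s l₃ = true ∨ s a = true ∨ s b = true ∨
      s c = true ∨ s x = true ∨ s y = true ∨ s z = true) :
    (s l₁ = true ∧ s x = true ∧ s b = true ∧ s c = true ∧
      s l₂ = false ∧ s l₃ = false ∧ s a = false ∧ s y = false ∧ s z = false) ∨
    (s l₂ = true ∧ s y = true ∧ s a = true ∧ s c = true ∧
      s l₁ = false ∧ s l₃ = false ∧ s b = false ∧ s x = false ∧ s z = false) ∨
    (s l₃ = true ∧ s z = true ∧ s a = true ∧ s b = true ∧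
      s l₁ = false ∧ s l₂ = false ∧ s c = false ∧ s x = false ∧ s y = false) := by
  cases e₁ : s l₁
  · cases e₂ : s l₂
    · cases e₃ : s l₃
      · have := hg.eq_false_of_literals hs e₁ e₂ e₃
        simp_all
      · have := hg.rotate_s5.rotate_s5.eq_of_literal hs e₃
        simp_all
    · have := hg.rotate_s5.eq_of_literal hs e₂
      simp_all
  · have := hg.eq_of_literal hs e₁
    simp_all
end

section
/- Let G contain two vertex-disjoint clause gadgets g1 and g2, with literal nodes l1,l2,l3 and l1',l2',l3' respectively, connected by a transfer node t whose neighbors in G are exactly the six literal nodes l1,l2,l3,l1',l2',l3'. Then in any pure Nash equilibrium of G for the Single-Neighbor pattern, if some vertex of g1 plays 1, then some vertex of g2 plays 1. -/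
theorem IsPNE.sn_iff {V : Type*} [Fintype V] {G : SimpleGraph V} {s : V → Bool}
    (hs : IsPNE G SN s) (v : V) : s v = true ↔ ∃! w, G.Adj v w ∧ s w = true := by
  have h := hs v
  unfold BestResponds SN at h
  rw [h, decide_eq_true_eq, Set.ncard_eq_one]
  simp only [Set.eq_singleton_iff_unique_mem, Set.mem_ofPred_eq, ExistsUnique]

theorem IsPNE.eq_of_adj_s7 {V : Type*} [Fintype V] {G : SimpleGraph V} {s : V → Bool}
    (hs : IsPNE G SN s) {v u w : V} (hv : s v = true) (hu : G.Adj u v) (hw : G.Adj w v)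
    (hsu : s u = true) (hsw : s w = true) : u = w :=
  ((hs.sn_iff v).1 hv).unique ⟨hu.symm, hsu⟩ ⟨hw.symm, hsw⟩

/-- Under the Single-Neighbor pattern, a vertex with four known neighbors plays 1 iff exactly
one of them does. -/
theorem IsPNE.sn_of_neighborSet {V : Type*} [Fintype V] {G : SimpleGraph V} {s : V → Bool}
    (hs : IsPNE G SN s) {v p q r u : V} (hv : G.neighborSet v = {p, q, r, u})
    (hd : [p, q, r, u].Pairwise (· ≠ ·)) :
    s v = decide ((s p).toNat + (s q).toNat + (s r).toNat + (s u).toNat = 1) := by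
  have hadj (w : V) : G.Adj v w ↔ w = p ∨ w = q ∨ w = r ∨ w = u := by
    rw [← G.mem_neighborSet, hv]; simp
  rw [Bool.eq_iff_iff, hs.sn_iff v, decide_eq_true_eq]
  simp only [hadj, ExistsUnique]
  simp only [List.pairwise_cons, List.mem_cons, List.not_mem_nil, or_false] at hd
  cases hp : s p <;> cases hq : s q <;> cases hr : s r <;> cases hu : s u <;> grind

/-- In a Single-Neighbor equilibrium in which some vertex of a clause gadget plays 1, exactly one
literal node of the gadget plays 1, and so does some peripheral node. -/
theorem ClauseGadget.literal_and_peripheral {V : Type*} [Fintype V] {G : SimpleGraph V}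
    {l₁ l₂ l₃ a b c x y z : V} (hg : ClauseGadget G l₁ l₂ l₃ a b c x y z)
    {s : V → Bool} (hs : IsPNE G SN s)
    (hone : s l₁ = true ∨ s l₂ = true ∨ s l₃ = true ∨ s a = true ∨ s b = true ∨
      s c = true ∨ s x = true ∨ s y = true ∨ s z = true) :
    (s l₁ = true ∧ s l₂ = false ∧ s l₃ = false ∨
      s l₁ = false ∧ s l₂ = true ∧ s l₃ = false ∨
      s l₁ = false ∧ s l₂ = false ∧ s l₃ = true) ∧
    (s x = true ∨ s y = true ∨ s z = true) := by
  have hd := hg.distinct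
  simp only [List.pairwise_cons, List.mem_cons, List.not_mem_nil, or_false] at hd
  have ha := hs.sn_of_neighborSet hg.nbhd_a (by simp; grind)
  have hb := hs.sn_of_neighborSet hg.nbhd_b (by simp; grind)
  have hc := hs.sn_of_neighborSet hg.nbhd_c (by simp; grind)
  have hx := hs.sn_of_neighborSet hg.nbhd_x (by simp; grind)
  have hy := hs.sn_of_neighborSet hg.nbhd_y (by simp; grind)
  have hz := hs.sn_of_neighborSet hg.nbhd_z (by simp; grind)
  have hal : G.Adj a l₁ := by rw [← G.mem_neighborSet, hg.nbhd_a]; simp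
  have hbl : G.Adj b l₂ := by rw [← G.mem_neighborSet, hg.nbhd_b]; simp
  have hcl : G.Adj c l₃ := by rw [← G.mem_neighborSet, hg.nbhd_c]; simp
  have h₁₂ := hg.adj_l₁l₂
  have h₁₃ := hg.adj_l₁l₃
  have h₂₃ := hg.adj_l₂l₃
  have h₁ : s l₁ = true → ¬(s l₂ = true ∧ s l₃ = true) ∧ ¬(s l₂ = true ∧ s a = true) ∧
      ¬(s l₃ = true ∧ s a = true) := fun h =>
    ⟨fun k => by grind [hs.eq_of_adj_s7 h h₁₂.symm h₁₃.symm k.1 k.2],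
      fun k => by grind [hs.eq_of_adj_s7 h h₁₂.symm hal k.1 k.2],
      fun k => by grind [hs.eq_of_adj_s7 h h₁₃.symm hal k.1 k.2]⟩
  have h₂ : s l₂ = true → ¬(s l₁ = true ∧ s b = true) ∧ ¬(s l₃ = true ∧ s b = true) := fun h =>
    ⟨fun k => by grind [hs.eq_of_adj_s7 h h₁₂ hbl k.1 k.2],
      fun k => by grind [hs.eq_of_adj_s7 h h₂₃.symm hbl k.1 k.2]⟩
  have h₃ : s l₃ = true → ¬(s l₁ = true ∧ s c = true) ∧ ¬(s l₂ = true ∧ s c = true) := fun h =>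
    ⟨fun k => by grind [hs.eq_of_adj_s7 h h₁₃ hcl k.1 k.2],
      fun k => by grind [hs.eq_of_adj_s7 h h₂₃ hcl k.1 k.2]⟩
  clear hd
  generalize s l₁ = L₁, s l₂ = L₂, s l₃ = L₃, s a = A, s b = B, s c = C, s x = X, s y = Y,
    s z = Z at *
  clear hg hs hal hbl hcl h₁₂ h₁₃ h₂₃
  subst hx hy hz
  revert L₁ L₂ L₃ A B C
  set_option synthInstance.maxSize 1000 in
  decide

/-- If `G` contains two vertex-disjoint clause gadgets connected by a transfer
node `t` whose neighbors are exactly the six literal nodes, then in any PNE for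
the Single-Neighbor pattern, if some vertex of the first gadget plays 1, then
some vertex of the second gadget plays 1. -/
theorem transferNode_transfers {V : Type*} [Fintype V] (G : SimpleGraph V)
    (l₁ l₂ l₃ a b c x y z l₁' l₂' l₃' a' b' c' x' y' z' t : V)
    (hg₁ : ClauseGadget G l₁ l₂ l₃ a b c x y z)
    (hg₂ : ClauseGadget G l₁' l₂' l₃' a' b' c' x' y' z')
    (hdisj : [l₁, l₂, l₃, a, b, c, x, y, z,
      l₁', l₂', l₃', a', b', c', x', y', z', t].Pairwise (· ≠ ·))
    (ht : G.neighborSet t = {l₁, l₂, l₃, l₁', l₂', l₃'})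
    (s : V → Bool) (hs : IsPNE G SN s)
    (hone : s l₁ = true ∨ s l₂ = true ∨ s l₃ = true ∨ s a = true ∨ s b = true ∨
      s c = true ∨ s x = true ∨ s y = true ∨ s z = true) :
    s l₁' = true ∨ s l₂' = true ∨ s l₃' = true ∨ s a' = true ∨ s b' = true ∨
      s c' = true ∨ s x' = true ∨ s y' = true ∨ s z' = true := by
  have hout := hg₁.literal_and_peripheral hs hone
  by_contra! h
  have hadj (w : V) : G.Adj t w ↔ w = l₁ ∨ w = l₂ ∨ w = l₃ ∨ w = l₁' ∨ w = l₂' ∨ w = l₃' := by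
    rw [← G.mem_neighborSet, ht]; simp
  have hper (p : V) (hp : p = x ∨ p = y ∨ p = z) :
      p ≠ t ∧ G.Adj p l₁ ∧ G.Adj p l₂ ∧ G.Adj p l₃ := by
    simp only [List.pairwise_cons, List.mem_cons, List.not_mem_nil, or_false] at hdisj
    refine ⟨by grind, ?_⟩
    simp only [← G.mem_neighborSet]
    rcases hp with rfl | rfl | rfl
    · simp [hg₁.nbhd_x]
    · simp [hg₁.nbhd_y]
    · simp [hg₁.nbhd_z]
  obtain ⟨p, hp, hsp⟩ : ∃ p, (p = x ∨ p = y ∨ p = z) ∧ s p = true := by grind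
  obtain ⟨hpt, hp₁, hp₂, hp₃⟩ := hper p hp
  obtain ⟨l, hl, hsl, hpl, hlt⟩ : ∃ l, G.Adj t l ∧ s l = true ∧ G.Adj p l ∧
      ∀ w, G.Adj t w → s w = true → w = l := by
    rcases hout.1 with k | k | k
    · exact ⟨l₁, by grind⟩
    · exact ⟨l₂, by grind⟩
    · exact ⟨l₃, by grind⟩
  have hst : s t = true := (hs.sn_iff t).2 ⟨l, ⟨hl, hsl⟩, fun w hw => hlt w hw.1 hw.2⟩
  exact hpt (hs.eq_of_adj_s7 hsl hpl hl hsp hst)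
end

section
/- Let G contain two vertex-disjoint clause gadgets g1 and g2, let l1 be a literal node of g1, let l1',l2',l3' be the literal nodes of g2, and let n be a negation node whose neighbors in G are exactly l1, l2' and l3'. Then in any pure Nash equilibrium of G for the Single-Neighbor pattern in which each of g1 and g2 has at least one vertex playing 1, n plays 0 and l1 and l1' play different values, i.e. s(l1) ≠ s(l1'). -/
open Finset in
lemma ncard_active_neighbors {V : Type*} (G : SimpleGraph V) (s : V → Bool) (u : V)
    (F : Finset V) (h : G.neighborSet u = F) :
    Set.ncard {w : V | G.Adj u w ∧ s w = true} = ∑ w ∈ F, (s w).toNat := by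
  have hset : {w : V | G.Adj u w ∧ s w = true} = (F.filter (fun w => s w = true) : Finset V) := by
    ext w
    simp [← SimpleGraph.mem_neighborSet, h]
  rw [hset, Set.ncard_coe_finset, card_filter]
  exact sum_congr rfl fun w _ => by cases s w <;> rfl

lemma IsPNE.eq_SN_sum {V : Type*} [Fintype V] {G : SimpleGraph V} {s : V → Bool}
    (hs : IsPNE G SN s) (u : V) (F : Finset V) (h : G.neighborSet u = F) :
    s u = SN (∑ w ∈ F, (s w).toNat) := by
  rw [← ncard_active_neighbors G s u F h]
  exact hs u

open Classical in
lemma IsPNE.sum_le_one {V : Type*} [Fintype V] {G : SimpleGraph V} {s : V → Bool}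
    (hs : IsPNE G SN s) (u : V) (F : Finset V) (h : ∀ w ∈ F, G.Adj u w) (hu : s u = true) :
    ∑ w ∈ F, (s w).toNat ≤ 1 := by
  have hsum := hs.eq_SN_sum u (G.neighborFinset u) (by simp)
  rw [hu, eq_comm, SN, decide_eq_true_iff] at hsum
  rw [← hsum]
  exact Finset.sum_le_sum_of_subset fun w hw => by simpa using h w hw

/-- The Boolean content of `ClauseGadget.exactly_one_literal`. -/
lemma exactly_one_literal_of_sums {l₁ l₂ l₃ a b c x y z : Bool}
    (hone : l₁ = true ∨ l₂ = true ∨ l₃ = true ∨ a = true ∨ b = true ∨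
      c = true ∨ x = true ∨ y = true ∨ z = true)
    (ha : a = SN (l₁.toNat + (b.toNat + (c.toNat + x.toNat))))
    (hb : b = SN (l₂.toNat + (a.toNat + (c.toNat + y.toNat))))
    (hc : c = SN (l₃.toNat + (a.toNat + (b.toNat + z.toNat))))
    (hx : x = SN (l₁.toNat + (l₂.toNat + (l₃.toNat + a.toNat))))
    (hy : y = SN (l₁.toNat + (l₂.toNat + (l₃.toNat + b.toNat))))
    (hz : z = SN (l₁.toNat + (l₂.toNat + (l₃.toNat + c.toNat))))
    (hl₁ : l₁ = true →
      l₂.toNat + (l₃.toNat + (a.toNat + (x.toNat + (y.toNat + z.toNat)))) ≤ 1)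
    (hl₂ : l₂ = true →
      l₁.toNat + (l₃.toNat + (b.toNat + (x.toNat + (y.toNat + z.toNat)))) ≤ 1)
    (hl₃ : l₃ = true →
      l₁.toNat + (l₂.toNat + (c.toNat + (x.toNat + (y.toNat + z.toNat)))) ≤ 1) :
    (l₁ = true ∧ l₂ = false ∧ l₃ = false ∧ x = true) ∨
    (l₁ = false ∧ l₂ = true ∧ l₃ = false ∧ y = true) ∨
    (l₁ = false ∧ l₂ = false ∧ l₃ = true ∧ z = true) := by
  cases l₁ <;> cases l₂ <;> cases l₃ <;> cases a <;> cases b <;> cases c <;>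
    grind [SN]

/-- In a Single-Neighbor equilibrium, an active clause gadget has exactly one literal node
playing 1, and the paired peripheral node plays 1 as well. -/
lemma ClauseGadget.exactly_one_literal {V : Type*} [Fintype V] {G : SimpleGraph V}
    {l₁ l₂ l₃ a b c x y z : V} (hg : ClauseGadget G l₁ l₂ l₃ a b c x y z)
    {s : V → Bool} (hs : IsPNE G SN s)
    (hone : s l₁ = true ∨ s l₂ = true ∨ s l₃ = true ∨ s a = true ∨ s b = true ∨
      s c = true ∨ s x = true ∨ s y = true ∨ s z = true) :
    (s l₁ = true ∧ s l₂ = false ∧ s l₃ = false ∧ s x = true) ∨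
    (s l₁ = false ∧ s l₂ = true ∧ s l₃ = false ∧ s y = true) ∨
    (s l₁ = false ∧ s l₂ = false ∧ s l₃ = true ∧ s z = true) := by
  classical
  obtain ⟨hd, h12, h13, h23, ha, hb, hc, hx, hy, hz⟩ := hg
  have ea := hs.eq_SN_sum a {l₁, b, c, x} (by simp [ha, Set.insert_comm _ l₁])
  have eb := hs.eq_SN_sum b {l₂, a, c, y} (by simp [hb, Set.insert_comm _ l₂])
  have ec := hs.eq_SN_sum c {l₃, a, b, z} (by simp [hc, Set.insert_comm _ l₃])
  have ex := hs.eq_SN_sum x {l₁, l₂, l₃, a} (by simp [hx, Set.insert_comm a, Set.pair_comm a])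
  have ey := hs.eq_SN_sum y {l₁, l₂, l₃, b} (by simp [hy, Set.insert_comm b, Set.pair_comm b])
  have ez := hs.eq_SN_sum z {l₁, l₂, l₃, c} (by simp [hz, Set.insert_comm c, Set.pair_comm c])
  have adj {u w : V} {S : Set V} (h : G.neighborSet u = S) (hw : w ∈ S) : G.Adj w u :=
    (show w ∈ G.neighborSet u by rwa [h]).symm
  have e1 := hs.sum_le_one l₁ {l₂, l₃, a, x, y, z} (by
    simp [h12, h13, adj ha, adj hx, adj hy, adj hz])
  have e2 := hs.sum_le_one l₂ {l₁, l₃, b, x, y, z} (by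
    simp [h12.symm, h23, adj hb, adj hx, adj hy, adj hz])
  have e3 := hs.sum_le_one l₃ {l₁, l₂, c, x, y, z} (by
    simp [h13.symm, h23.symm, adj hc, adj hx, adj hy, adj hz])
  simp only [List.pairwise_cons, List.mem_cons, forall_eq_or_imp, List.not_mem_nil] at hd
  rw [Finset.sum_insert (by simp [hd]), Finset.sum_insert (by simp [hd]),
    Finset.sum_insert (by simp [hd]), Finset.sum_singleton] at ea eb ec ex ey ez
  rw [Finset.sum_insert (by simp [hd]), Finset.sum_insert (by simp [hd]),
    Finset.sum_insert (by simp [hd]), Finset.sum_insert (by simp [hd]),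
    Finset.sum_insert (by simp [hd]), Finset.sum_singleton] at e1 e2 e3
  exact exactly_one_literal_of_sums hone ea eb ec ex ey ez e1 e2 e3

/-- If `G` contains two vertex-disjoint clause gadgets `g₁`, `g₂`, a literal node
`l₁` of `g₁` and the literal nodes `l₁', l₂', l₃'` of `g₂`, and a negation node `n`
whose neighbors are exactly `l₁`, `l₂'`, `l₃'`, then in any PNE for the
Single-Neighbor pattern in which each gadget has a vertex playing 1, `n` plays 0
and `l₁`, `l₁'` play different values. -/
theorem negationNode_negates {V : Type*} [Fintype V] (G : SimpleGraph V)
    (l₁ l₂ l₃ a b c x y z l₁' l₂' l₃' a' b' c' x' y' z' n : V)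
    (hg₁ : ClauseGadget G l₁ l₂ l₃ a b c x y z)
    (hg₂ : ClauseGadget G l₁' l₂' l₃' a' b' c' x' y' z')
    (hdisj : [l₁, l₂, l₃, a, b, c, x, y, z,
      l₁', l₂', l₃', a', b', c', x', y', z', n].Pairwise (· ≠ ·))
    (hn : G.neighborSet n = {l₁, l₂', l₃'})
    (s : V → Bool) (hs : IsPNE G SN s)
    (hone₁ : s l₁ = true ∨ s l₂ = true ∨ s l₃ = true ∨ s a = true ∨ s b = true ∨
      s c = true ∨ s x = true ∨ s y = true ∨ s z = true)
    (hone₂ : s l₁' = true ∨ s l₂' = true ∨ s l₃' = true ∨ s a' = true ∨ s b' = true ∨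
      s c' = true ∨ s x' = true ∨ s y' = true ∨ s z' = true) :
    s n = false ∧ s l₁ ≠ s l₁' := by
  classical
  simp only [List.pairwise_cons, List.mem_cons, forall_eq_or_imp, List.not_mem_nil] at hdisj
  have adj_n {w : V} (hw : w ∈ ({l₁, l₂', l₃'} : Set V)) : G.Adj w n :=
    (show w ∈ G.neighborSet n by rwa [hn]).symm
  have not_both {l p : V} (hl : s l = true) (hp : s p = true) (hlp : G.Adj l p)
      (hln : G.Adj l n) (hpn : p ≠ n) : s n = false := by
    have h := hs.sum_le_one l {p, n} (by simp [hlp, hln]) hl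
    rw [Finset.sum_pair hpn, hp] at h
    cases hsn : s n <;> simp_all
  have hxl : G.Adj l₁ x := (show l₁ ∈ G.neighborSet x by simp [hg₁.nbhd_x]).symm
  have hyl : G.Adj l₂' y' := (show l₂' ∈ G.neighborSet y' by simp [hg₂.nbhd_y]).symm
  have hzl : G.Adj l₃' z' := (show l₃' ∈ G.neighborSet z' by simp [hg₂.nbhd_z]).symm
  have n₁ := fun h h' => not_both h h' hxl (adj_n (by simp)) (by simp [hdisj])
  have n₂ := fun h h' => not_both h h' hyl (adj_n (by simp)) (by simp [hdisj])
  have n₃ := fun h h' => not_both h h' hzl (adj_n (by simp)) (by simp [hdisj])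
  have hsum := hs.eq_SN_sum n {l₁, l₂', l₃'} (by simpa using hn)
  rw [Finset.sum_insert (by simp [hdisj]), Finset.sum_insert (by simp [hdisj]),
    Finset.sum_singleton] at hsum
  rcases hg₁.exactly_one_literal hs hone₁ with h | h | h <;>
    rcases hg₂.exactly_one_literal hs hone₂ with h' | h' | h' <;>
    simp_all [SN]
end

section
/- Let T' : ℕ → {0,1} satisfy T'(0) = T'(1) = 1, and let m' ≥ 3 satisfy T'(m'-1) = 0 and T'(m') = 1. Let G be a graph containing a vertex v with a Force-1-gadget attached to it. Then in any pure Nash equilibrium of G for T', every node of the Force-1-gadget plays 1 and v plays 1. -/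
theorem BestResponds.eq_true_of_subset_singleton {V : Type*} [Fintype V] {G : SimpleGraph V}
    {T : ℕ → Bool} {s : V → Bool} {u : V} (h : BestResponds G T s u)
    (h0 : T 0 = true) (h1 : T 1 = true) (c : V)
    (hc : {x : V | G.Adj u x ∧ s x = true} ⊆ {c}) : s u = true := by
  unfold BestResponds at h
  rcases Set.subset_singleton_iff_eq.1 hc with hc | hc <;> rw [h, hc] <;> simp [h0, h1]

theorem BestResponds.eq_of_range_eq_true {V : Type*} [Fintype V] {G : SimpleGraph V}
    {T : ℕ → Bool} {s : V → Bool} {u c : V} {n : ℕ} {f : Fin n → V}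
    (h : BestResponds G T s u) (hu : G.neighborSet u = {c} ∪ Set.range f)
    (hf : Function.Injective f) (hc : ∀ i, f i ≠ c) (hs : ∀ i, s (f i) = true) :
    s u = T (if s c = true then n + 1 else n) := by
  unfold BestResponds at h
  have hadj (x : V) : G.Adj u x ↔ x = c ∨ ∃ i, f i = x := by
    rw [← SimpleGraph.mem_neighborSet, hu]
    simp
  have hcard : (Set.range f).ncard = n := by
    rw [← Set.image_univ, Set.ncard_image_of_injective _ hf, Set.ncard_univ, Nat.card_fin]
  rw [h]
  congr 1
  split_ifs with hsc
  · have : {x : V | G.Adj u x ∧ s x = true} = insert c (Set.range f) := by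
      ext x
      simp only [Set.mem_ofPred_eq, hadj, Set.mem_insert_iff, Set.mem_range]
      grind
    rw [this, Set.ncard_insert_of_notMem (by simpa using hc), hcard]
  · have : {x : V | G.Adj u x ∧ s x = true} = Set.range f := by
      ext x
      simp only [Set.mem_ofPred_eq, hadj, Set.mem_range]
      grind
    rw [this, hcard]

/-- Let `T'` satisfy `T' 0 = T' 1 = 1`, and let `m' ≥ 3` satisfy `T' (m'-1) = 0`
and `T' m' = 1`.  Suppose `G` contains a vertex `v` with a Force-1-gadget attached:
a bridge node `b` adjacent to `v`, second-layer nodes `w i` (`i : Fin (m'-1)`) each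
adjacent to `b`, and leaves `leaf i j` (`j : Fin (m'-1)`) each adjacent only to `w i`,
all these vertices distinct and with no other neighbors in `G`.  Then in any PNE of
`G` for `T'`, every gadget node plays 1 and `v` plays 1. -/
theorem force1Gadget_forces_one {V : Type*} [Fintype V] (G : SimpleGraph V)
    (T' : ℕ → Bool) (m' : ℕ) (hm' : 3 ≤ m')
    (h0 : T' 0 = true) (h1 : T' 1 = true)
    (hpred : T' (m' - 1) = false) (hm : T' m' = true)
    (v b : V) (w : Fin (m' - 1) → V) (leaf : Fin (m' - 1) → Fin (m' - 1) → V)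
    (hbv : b ≠ v)
    (hw_inj : Function.Injective w)
    (hw_ne : ∀ i, w i ≠ b ∧ w i ≠ v)
    (hleaf_inj : ∀ i j i' j', leaf i j = leaf i' j' → i = i' ∧ j = j')
    (hleaf_ne : ∀ i j, leaf i j ≠ b ∧ leaf i j ≠ v ∧ ∀ i', leaf i j ≠ w i')
    (hnb : G.neighborSet b = {v} ∪ Set.range w)
    (hnw : ∀ i, G.neighborSet (w i) = {b} ∪ Set.range (leaf i))
    (hnl : ∀ i j, G.neighborSet (leaf i j) = {w i})
    (s : V → Bool) (hs : IsPNE G T' s) :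
    s v = true ∧ s b = true ∧ (∀ i, s (w i) = true) ∧ (∀ i j, s (leaf i j) = true) := by
  have hleaf (i j) : s (leaf i j) = true := by
    refine (hs (leaf i j)).eq_true_of_subset_singleton h0 h1 (w i) ?_
    rw [← hnl i j]
    exact fun x hx => hx.1
  have hsucc : m' - 1 + 1 = m' := by omega
  have hw (i) : s (w i) = s b := by
    rw [(hs (w i)).eq_of_range_eq_true (hnw i) (fun j j' hj => (hleaf_inj i j i j' hj).2)
      (fun j => (hleaf_ne i j).1) (hleaf i), hsucc]
    cases s b <;> simp [hpred, hm]
  have hb : s b = true := by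
    by_contra hb
    refine hb ((hs b).eq_true_of_subset_singleton h0 h1 v ?_)
    rintro x ⟨hx, hsx⟩
    rw [← SimpleGraph.mem_neighborSet, hnb] at hx
    rcases hx with hx | ⟨i, rfl⟩
    · exact hx
    · exact absurd ((hw i).symm.trans hsx) hb
  have hw_true (i) : s (w i) = true := (hw i).trans hb
  refine ⟨?_, hb, hw_true, hleaf⟩
  have hbv_resp := (hs b).eq_of_range_eq_true hnb hw_inj (fun i => (hw_ne i).2) hw_true
  by_contra hv
  rw [if_neg hv, hpred, hb] at hbv_resp
  contradiction
end

section
/- Let m ≥ 2 and let T' : ℕ → {0,1} satisfy T'(0) = 1, T'(k) = 0 for all 1 ≤ k < m, and T'(m) = T'(m+1) = 1. Let G be a graph containing a vertex v with a node gadget attached to it, with bridge node b. Then in any pure Nash equilibrium of G for T', b plays 1. Moreover, the assignment in which all m+1 clique nodes play 1 and all antenna nodes play 0 makes every node of the gadget play its best response, regardless of the value played by v. -/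
/-- In a node gadget, the number of active neighbors of the bridge node splits into the
contributions of the attachment vertex, the clique and the antennas. -/
theorem ncard_active_neighbors_bridge {V ι κ : Type*} [Fintype V] [Finite ι] [Finite κ]
    (G : SimpleGraph V) (s : V → Bool) {v b : V} {q : ι → V} {ant : κ → V}
    (hq_inj : Function.Injective q) (hq_ne : ∀ i, q i ≠ v)
    (hant_inj : Function.Injective ant) (hant_ne : ∀ i, ant i ≠ v ∧ ∀ j, ant i ≠ q j)
    (hnb : G.neighborSet b = {v} ∪ Set.range q ∪ Set.range ant) :
    Set.ncard {w : V | G.Adj b w ∧ s w = true} =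
      (s v).toNat + Set.ncard {i | s (q i) = true} + Set.ncard {i | s (ant i) = true} := by
  have hadj : ∀ w, G.Adj b w ↔ (w = v ∨ ∃ i, q i = w) ∨ ∃ i, ant i = w := fun w => by
    rw [← SimpleGraph.mem_neighborSet, hnb]
    simp
  have hset : {w : V | G.Adj b w ∧ s w = true} =
      ({w | w = v ∧ s v = true} ∪ q '' {i | s (q i) = true}) ∪
        ant '' {i | s (ant i) = true} := by
    ext w
    simp only [hadj, Set.mem_ofPred_eq, Set.mem_union, Set.mem_image]
    grind
  rw [hset, Set.ncard_union_eq, Set.ncard_union_eq, Set.ncard_image_of_injective _ hq_inj,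
    Set.ncard_image_of_injective _ hant_inj]
  · cases s v <;> simp
  · rw [Set.disjoint_left]
    rintro _ ⟨rfl, -⟩ ⟨i, -, hi⟩
    exact hq_ne i hi
  · rw [Set.disjoint_left]
    rintro _ (⟨rfl, -⟩ | ⟨j, -, rfl⟩) ⟨i, -, hi⟩
    · exact (hant_ne i).1 hi
    · exact (hant_ne i).2 j hi

/-- In a node gadget, the number of active neighbors of a non-bridge clique node, increased by
its own action, is the number of active clique nodes. -/
theorem ncard_active_neighbors_clique {V ι : Type*} [Fintype V] [Finite ι]
    (G : SimpleGraph V) (s : V → Bool) {b : V} {q : ι → V}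
    (hq_inj : Function.Injective q) (hq_ne : ∀ i, q i ≠ b) {i : ι}
    (hnq : G.neighborSet (q i) = insert b (Set.range q \ {q i})) :
    Set.ncard {w : V | G.Adj (q i) w ∧ s w = true} + (s (q i)).toNat =
      (s b).toNat + Set.ncard {j | s (q j) = true} := by
  have hadj : ∀ w, G.Adj (q i) w ↔ w = b ∨ (∃ j, q j = w) ∧ w ≠ q i := fun w => by
    rw [← SimpleGraph.mem_neighborSet, hnq]
    simp
  have hleft : Set.ncard ({w : V | G.Adj (q i) w ∧ s w = true} ∪
      {w | w = q i ∧ s (q i) = true}) =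
      Set.ncard {w : V | G.Adj (q i) w ∧ s w = true} + (s (q i)).toNat := by
    rw [Set.ncard_union_eq]
    · cases s (q i) <;> simp
    · rw [Set.disjoint_left]
      rintro _ ⟨h, -⟩ ⟨rfl, -⟩
      exact G.irrefl h
  have hright : Set.ncard ({w | w = b ∧ s b = true} ∪ q '' {j | s (q j) = true}) =
      (s b).toNat + Set.ncard {j | s (q j) = true} := by
    rw [Set.ncard_union_eq, Set.ncard_image_of_injective _ hq_inj]
    · cases s b <;> simp
    · rw [Set.disjoint_left]
      rintro _ ⟨rfl, -⟩ ⟨j, -, hj⟩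
      exact hq_ne j hj
  rw [← hleft, ← hright]
  congr 1
  ext w
  simp only [hadj, Set.mem_ofPred_eq, Set.mem_union, Set.mem_image]
  grind

/-- The number of active neighbors of a leaf is the action of its only neighbor. -/
theorem ncard_active_neighbors_leaf {V : Type*} [Fintype V]
    (G : SimpleGraph V) (s : V → Bool) {a b : V} (hna : G.neighborSet a = {b}) :
    Set.ncard {w : V | G.Adj a w ∧ s w = true} = (s b).toNat := by
  have hset : {w : V | G.Adj a w ∧ s w = true} = {w | w = b ∧ s b = true} := by
    ext w
    rw [Set.mem_ofPred_eq, ← SimpleGraph.mem_neighborSet, hna]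
    simp only [Set.mem_singleton_iff, Set.mem_ofPred_eq]
    grind
  rw [hset]
  cases s b <;> simp


/-- Let `m ≥ 2` and let `T'` satisfy `T' 0 = 1`, `T' k = 0` for `1 ≤ k < m`, and
`T' m = T' (m+1) = 1`.  Suppose `G` contains a vertex `v` with a node gadget
attached: an `(m+1)`-clique consisting of the bridge node `b` and nodes `q i`
(`i : Fin m`), antennas `ant i` (`i : Fin (m-1)`) adjacent only to `b`, and the
edge between `b` and `v`, all these vertices distinct and with no other neighbors
in `G`.  Then in any PNE of `G` for `T'`, `b` plays 1; moreover the assignment in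
which all `m+1` clique nodes play 1 and all antennas play 0 makes every gadget
node play its best response, regardless of the value played by `v`. -/
theorem nodeGadget_bridge_plays_one {V : Type*} [Fintype V] (G : SimpleGraph V)
    (T' : ℕ → Bool) (m : ℕ) (hm : 2 ≤ m)
    (h0 : T' 0 = true) (hmid : ∀ k, 1 ≤ k → k < m → T' k = false)
    (hTm : T' m = true) (hTm1 : T' (m + 1) = true)
    (v b : V) (q : Fin m → V) (ant : Fin (m - 1) → V)
    (hbv : b ≠ v)
    (hq_inj : Function.Injective q)
    (hq_ne : ∀ i, q i ≠ b ∧ q i ≠ v)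
    (hant_inj : Function.Injective ant)
    (hant_ne : ∀ i, ant i ≠ b ∧ ant i ≠ v ∧ ∀ j, ant i ≠ q j)
    (hnb : G.neighborSet b = {v} ∪ Set.range q ∪ Set.range ant)
    (hnq : ∀ i, G.neighborSet (q i) = insert b (Set.range q \ {q i}))
    (hna : ∀ i, G.neighborSet (ant i) = {b}) :
    (∀ s : V → Bool, IsPNE G T' s → s b = true) ∧
    (∀ s : V → Bool, s b = true → (∀ i, s (q i) = true) → (∀ i, s (ant i) = false) →
      BestResponds G T' s b ∧ (∀ i, BestResponds G T' s (q i)) ∧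
      (∀ i, BestResponds G T' s (ant i))) := by
  have hb := fun s => ncard_active_neighbors_bridge G s hq_inj (fun i => (hq_ne i).2)
    hant_inj (fun i => (hant_ne i).2) hnb
  have hq := fun s i => ncard_active_neighbors_clique G s hq_inj (fun i => (hq_ne i).1) (hnq i)
  have ha := fun s i => ncard_active_neighbors_leaf G s (hna i)
  constructor
  · intro s hs
    by_contra hsb
    rw [Bool.not_eq_true] at hsb
    have hant : ∀ i, s (ant i) = true := fun i => by
      rw [hs (ant i), ha, hsb]
      exact h0
    have hbr := hs b
    rw [BestResponds, hb, hsb] at hbr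
    simp only [hant, Set.ofPred_true, Set.ncard_univ, Nat.card_eq_fintype_card,
      Fintype.card_fin] at hbr
    have hle : Set.ncard {i | s (q i) = true} ≤ m := by
      simpa using Set.ncard_le_card {i | s (q i) = true}
    have hclique : ∀ i, s (q i) = T' (Set.ncard {w : V | G.Adj (q i) w ∧ s w = true}) :=
      fun i => hs (q i)
    have hcount := hq s
    simp only [hsb, Bool.toNat_false, zero_add] at hcount
    generalize hc : Set.ncard {i | s (q i) = true} = c at *
    have hactive : ∀ i, s (q i) = true → c = 1 := fun i hi => by
      have h1 := hcount i
      have h2 := hclique i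
      rw [hi, Bool.toNat_true] at h1
      rw [hi] at h2
      by_contra hne
      rw [hmid _ (by omega) (by omega)] at h2
      exact absurd h2 (by simp)
    have hc1 : c = 1 := by
      by_cases hex : ∃ i, s (q i) = true
      · obtain ⟨i, hi⟩ := hex
        exact hactive i hi
      · simp only [not_exists, Bool.not_eq_true] at hex
        have hc0 : c = 0 := by simpa [hex] using hc.symm
        have h1 := hcount ⟨0, by omega⟩
        have h2 := hclique ⟨0, by omega⟩
        rw [hex, Bool.toNat_false, add_zero, hc0] at h1
        rw [hex, h1, h0] at h2
        exact absurd h2 (by simp)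
    subst hc1
    cases hv : s v
    · rw [hv, Bool.toNat_false, show 0 + 1 + (m - 1) = m by omega, hTm] at hbr
      exact absurd hbr (by simp)
    · rw [hv, Bool.toNat_true, show 1 + 1 + (m - 1) = m + 1 by omega, hTm1] at hbr
      exact absurd hbr (by simp)
  · intro s hsb hsq hsa
    refine ⟨?_, fun i => ?_, fun i => ?_⟩
    · rw [BestResponds, hb, hsb]
      cases hv : s v
      · simp [hsq, hsa, hTm]
      · simp [hsq, hsa, add_comm 1 m, hTm1]
    · have h1 := hq s i
      simp only [hsq, hsb, Bool.toNat_true, Set.ofPred_true, Set.ncard_univ,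
        Nat.card_eq_fintype_card, Fintype.card_fin] at h1
      rw [BestResponds, hsq, show Set.ncard {w : V | G.Adj (q i) w ∧ s w = true} = m by omega,
        hTm]
    · rw [BestResponds, hsa, ha, hsb, Bool.toNat_true, hmid 1 le_rfl (by omega)]
end

section
/- Let T' : ℕ → {0,1} satisfy T'(0) = 1, T'(1) = 0 and T'(2) = 1. Let G be a graph containing a vertex v with a 4-cycle gadget attached to it: vertices a,b,c,d with edges a–b, b–c, c–d, d–a, and with v adjacent to both a and b, where a,b,c,d have no other neighbors in G. Then in any pure Nash equilibrium of G for T', a and b both play 1. Moreover, if v plays 0 then the assignment a = b = c = d = 1 makes all four gadget nodes play their best responses, and if v plays 1 then the assignment a = b = 1, c = d = 0 does so. -/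
/-- The number of neighbors playing 1, when the neighborhood is listed as a finset. -/
theorem ncard_adj_playing_one {V : Type*} [DecidableEq V] (G : SimpleGraph V) (s : V → Bool)
    (u : V) (N : Finset V) (hN : G.neighborSet u = N) :
    Set.ncard {w : V | G.Adj u w ∧ s w = true} = ∑ w ∈ N, (s w).toNat := by
  have hset : {w : V | G.Adj u w ∧ s w = true} = (N.filter (fun w => s w = true) : Finset V) := by
    ext w
    have hw : G.Adj u w ↔ w ∈ N := by
      rw [← SimpleGraph.mem_neighborSet, hN, Finset.mem_coe]
    simp [hw]
  rw [hset, Set.ncard_coe_finset, Finset.card_filter]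
  refine Finset.sum_congr rfl fun w _ => ?_
  cases s w <;> rfl

/-- Best response of a vertex with exactly two neighbors. -/
theorem bestResponds_iff_of_neighborSet_eq_pair {V : Type*} [Fintype V] (G : SimpleGraph V)
    (T : ℕ → Bool) (s : V → Bool) {u x y : V} (hxy : x ≠ y) (hu : G.neighborSet u = {x, y}) :
    BestResponds G T s u ↔ s u = T ((s x).toNat + (s y).toNat) := by
  classical
  rw [BestResponds, ncard_adj_playing_one G s u {x, y} (by simpa using hu),
    Finset.sum_pair hxy]

/-- Best response of a vertex with exactly three neighbors. -/
theorem bestResponds_iff_of_neighborSet_eq_triple {V : Type*} [Fintype V] (G : SimpleGraph V)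
    (T : ℕ → Bool) (s : V → Bool) {u x y z : V} (hxy : x ≠ y) (hxz : x ≠ z) (hyz : y ≠ z)
    (hu : G.neighborSet u = {x, y, z}) :
    BestResponds G T s u ↔ s u = T ((s x).toNat + ((s y).toNat + (s z).toNat)) := by
  classical
  rw [BestResponds, ncard_adj_playing_one G s u {x, y, z} (by simpa using hu),
    Finset.sum_insert (by simp [hxy, hxz]), Finset.sum_pair hyz]

/-- Let `T'` satisfy `T' 0 = 1`, `T' 1 = 0`, `T' 2 = 1`, and let `G` contain a
vertex `v` with a 4-cycle gadget attached: vertices `a b c d` with edges `a–b`,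
`b–c`, `c–d`, `d–a`, with `v` adjacent to `a` and `b`, where `a,b,c,d` have no
other neighbors.  Then in any PNE of `G` for `T'`, `a` and `b` both play 1;
moreover if `v` plays 0 then the assignment `a = b = c = d = 1` makes all four
gadget nodes play best responses, and if `v` plays 1 then the assignment
`a = b = 1`, `c = d = 0` does so. -/
theorem cycleGadget_ab_play_one {V : Type*} [Fintype V] (G : SimpleGraph V)
    (T' : ℕ → Bool) (h0 : T' 0 = true) (h1 : T' 1 = false) (h2 : T' 2 = true)
    (v a b c d : V)
    (hdist : [v, a, b, c, d].Pairwise (· ≠ ·))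
    (hna : G.neighborSet a = {b, d, v})
    (hnb : G.neighborSet b = {a, c, v})
    (hnc : G.neighborSet c = {b, d})
    (hnd : G.neighborSet d = {a, c}) :
    (∀ s : V → Bool, IsPNE G T' s → s a = true ∧ s b = true) ∧
    (∀ s : V → Bool, s v = false → s a = true → s b = true → s c = true → s d = true →
      BestResponds G T' s a ∧ BestResponds G T' s b ∧
      BestResponds G T' s c ∧ BestResponds G T' s d) ∧
    (∀ s : V → Bool, s v = true → s a = true → s b = true → s c = false → s d = false →
      BestResponds G T' s a ∧ BestResponds G T' s b ∧
      BestResponds G T' s c ∧ BestResponds G T' s d) := by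
  simp only [List.pairwise_cons, List.mem_cons, List.not_mem_nil, or_false, forall_eq_or_imp,
    forall_eq] at hdist
  obtain ⟨⟨hva, hvb, hvc, hvd⟩, ⟨hab, hac, had⟩, ⟨hbc, hbd⟩, hcd, -⟩ := hdist
  have ha (s : V → Bool) :=
    bestResponds_iff_of_neighborSet_eq_triple G T' s hbd hvb.symm hvd.symm hna
  have hb (s : V → Bool) :=
    bestResponds_iff_of_neighborSet_eq_triple G T' s hac hva.symm hvc.symm hnb
  have hc (s : V → Bool) := bestResponds_iff_of_neighborSet_eq_pair G T' s hbd hnc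
  have hd (s : V → Bool) := bestResponds_iff_of_neighborSet_eq_pair G T' s hac hnd
  refine ⟨fun s hs => ?_, fun s sv sa sb sc sd => ?_, fun s sv sa sb sc sd => ?_⟩
  · have ea := (ha s).1 (hs a)
    have eb := (hb s).1 (hs b)
    have ec := (hc s).1 (hs c)
    have ed := (hd s).1 (hs d)
    cases hsv : s v <;> cases hsa : s a <;> cases hsb : s b <;> cases hsc : s c <;>
      cases hsd : s d <;> simp [hsv, hsa, hsb, hsc, hsd, h0, h1, h2] at ea eb ec ed ⊢
  · simp [ha, hb, hc, hd, sv, sa, sb, sc, sd, h2]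
  · simp [ha, hb, hc, hd, sv, sa, sb, sc, sd, h1, h2]
end

section
/- Let T : ℕ → {0,1} be non-flat, i.e. T(0) = 1, and let T' : ℕ → {0,1} satisfy T'(0) = 1, T'(1) = 0, and T'(k+2) = T(k) for all k ∈ ℕ. Let G be a finite simple graph and let G' be obtained from G by attaching to each vertex v of G a fresh 4-cycle gadget: new vertices a_v, b_v, c_v, d_v with edges a_v–b_v, b_v–c_v, c_v–d_v, d_v–a_v, v–a_v, v–b_v, where the gadget vertices have no other neighbors. Then G admits a non-trivial pure Nash equilibrium for T if and only if G' admits a non-trivial pure Nash equilibrium for T'. -/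
/-- The graph obtained from `G` by attaching to every vertex `v` a fresh 4-cycle
gadget `a_v = (v,0)`, `b_v = (v,1)`, `c_v = (v,2)`, `d_v = (v,3)` with edges
`a_v–b_v`, `b_v–c_v`, `c_v–d_v`, `d_v–a_v`, `v–a_v`, `v–b_v`. -/
def attachCycleGadgets {V : Type*} (G : SimpleGraph V) :
    SimpleGraph (V ⊕ (V × Fin 4)) :=
  SimpleGraph.fromRel (fun p q =>
    match p, q with
    | Sum.inl u, Sum.inl u' => G.Adj u u'
    | Sum.inl u, Sum.inr (u', i) => u = u' ∧ (i = 0 ∨ i = 1)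
    | Sum.inr (u, i), Sum.inr (u', j) => u = u' ∧ (i.val + 1) % 4 = j.val
    | _, _ => False)

theorem ncard_setOf_mem_and_eq_true {α : Type*} [DecidableEq α] (F : Finset α) (s : α → Bool) :
    {w | w ∈ F ∧ s w = true}.ncard = ∑ w ∈ F, (s w).toNat := by
  have : {w | w ∈ F ∧ s w = true} = (F.filter (fun w => s w = true) : Finset α) := by
    ext; simp
  rw [this, Set.ncard_coe_finset, Finset.card_filter]
  exact Finset.sum_congr rfl fun w _ => by cases s w <;> rfl

section Neighbors

variable {V : Type*} (G : SimpleGraph V) (v : V)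

theorem attachCycleGadgets_adj_inr_zero (w : V ⊕ (V × Fin 4)) :
    (attachCycleGadgets G).Adj (.inr (v, 0)) w ↔
      w = .inr (v, 1) ∨ w = .inr (v, 3) ∨ w = .inl v := by
  rcases w with u | ⟨u, i⟩
  · simp [attachCycleGadgets]
  · fin_cases i <;> simp [attachCycleGadgets, eq_comm]

theorem attachCycleGadgets_adj_inr_one (w : V ⊕ (V × Fin 4)) :
    (attachCycleGadgets G).Adj (.inr (v, 1)) w ↔
      w = .inr (v, 0) ∨ w = .inr (v, 2) ∨ w = .inl v := by
  rcases w with u | ⟨u, i⟩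
  · simp [attachCycleGadgets]
  · fin_cases i <;> simp [attachCycleGadgets, eq_comm]

theorem attachCycleGadgets_adj_inr_two (w : V ⊕ (V × Fin 4)) :
    (attachCycleGadgets G).Adj (.inr (v, 2)) w ↔ w = .inr (v, 1) ∨ w = .inr (v, 3) := by
  rcases w with u | ⟨u, i⟩
  · simp [attachCycleGadgets]
  · fin_cases i <;> simp [attachCycleGadgets, eq_comm]

theorem attachCycleGadgets_adj_inr_three (w : V ⊕ (V × Fin 4)) :
    (attachCycleGadgets G).Adj (.inr (v, 3)) w ↔ w = .inr (v, 0) ∨ w = .inr (v, 2) := by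
  rcases w with u | ⟨u, i⟩
  · simp [attachCycleGadgets]
  · fin_cases i <;> simp [attachCycleGadgets, eq_comm]

theorem attachCycleGadgets_adj_inl_inl (u : V) :
    (attachCycleGadgets G).Adj (.inl v) (.inl u) ↔ G.Adj v u := by
  simp only [attachCycleGadgets, SimpleGraph.fromRel_adj, ne_eq, Sum.inl.injEq, G.adj_comm u v,
    or_self, and_iff_right_iff_imp]
  exact fun h => h.ne

theorem attachCycleGadgets_adj_inl_inr (u : V) (i : Fin 4) :
    (attachCycleGadgets G).Adj (.inl v) (.inr (u, i)) ↔ v = u ∧ (i = 0 ∨ i = 1) := by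
  simp [attachCycleGadgets]

variable [Fintype V] {G v} {T : ℕ → Bool} {s : V ⊕ (V × Fin 4) → Bool}

theorem bestResponds_inr_zero :
    BestResponds (attachCycleGadgets G) T s (.inr (v, 0)) ↔
      s (.inr (v, 0)) =
        T ((s (.inr (v, 1))).toNat + ((s (.inr (v, 3))).toNat + (s (.inl v)).toNat)) := by
  classical
  have := ncard_setOf_mem_and_eq_true {.inr (v, 1), .inr (v, 3), .inl v} s
  simp at this
  simp [BestResponds, attachCycleGadgets_adj_inr_zero, this]

theorem bestResponds_inr_one :
    BestResponds (attachCycleGadgets G) T s (.inr (v, 1)) ↔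
      s (.inr (v, 1)) =
        T ((s (.inr (v, 0))).toNat + ((s (.inr (v, 2))).toNat + (s (.inl v)).toNat)) := by
  classical
  have := ncard_setOf_mem_and_eq_true {.inr (v, 0), .inr (v, 2), .inl v} s
  simp at this
  simp [BestResponds, attachCycleGadgets_adj_inr_one, this]

theorem bestResponds_inr_two :
    BestResponds (attachCycleGadgets G) T s (.inr (v, 2)) ↔
      s (.inr (v, 2)) = T ((s (.inr (v, 1))).toNat + (s (.inr (v, 3))).toNat) := by
  classical
  have := ncard_setOf_mem_and_eq_true {.inr (v, 1), .inr (v, 3)} s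
  simp at this
  simp [BestResponds, attachCycleGadgets_adj_inr_two, this]

theorem bestResponds_inr_three :
    BestResponds (attachCycleGadgets G) T s (.inr (v, 3)) ↔
      s (.inr (v, 3)) = T ((s (.inr (v, 0))).toNat + (s (.inr (v, 2))).toNat) := by
  classical
  have := ncard_setOf_mem_and_eq_true {.inr (v, 0), .inr (v, 2)} s
  simp at this
  simp [BestResponds, attachCycleGadgets_adj_inr_three, this]

theorem bestResponds_inl (ha : s (.inr (v, 0)) = true) (hb : s (.inr (v, 1)) = true) :
    BestResponds (attachCycleGadgets G) T s (.inl v) ↔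
      BestResponds G (fun k => T (k + 2)) (fun u => s (.inl u)) v := by
  have hset : {w | (attachCycleGadgets G).Adj (.inl v) w ∧ s w = true} =
      Sum.inl '' {u | G.Adj v u ∧ s (.inl u) = true} ∪ {.inr (v, 0), .inr (v, 1)} := by
    ext w
    rcases w with u | ⟨u, i⟩
    · simp [attachCycleGadgets_adj_inl_inl]
    · simp only [Set.mem_ofPred_eq, attachCycleGadgets_adj_inl_inr]
      simp
      grind
  have hdisj : Disjoint (Sum.inl '' {u | G.Adj v u ∧ s (.inl u) = true})
      ({.inr (v, 0), .inr (v, 1)} : Set (V ⊕ (V × Fin 4))) := by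
    simp [Set.disjoint_left]
  rw [BestResponds, BestResponds, hset, Set.ncard_union_eq hdisj,
    Set.ncard_image_of_injective _ Sum.inl_injective, Set.ncard_pair (by simp)]

end Neighbors

/-- In a gadget at equilibrium, both vertices attached to the base graph play 1. -/
theorem gadget_attached_eq_true {T : ℕ → Bool} (h0 : T 0 = true) (h1 : T 1 = false)
    (h2 : T 2 = true) {x a b c d : Bool}
    (ha : a = T (b.toNat + (d.toNat + x.toNat))) (hb : b = T (a.toNat + (c.toNat + x.toNat)))
    (hc : c = T (b.toNat + d.toNat)) (hd : d = T (a.toNat + c.toNat)) :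
    a = true ∧ b = true := by
  revert ha hb hc hd
  cases a <;> cases b <;> cases c <;> cases d <;> cases x <;> simp [h0, h1, h2]

/-- Extends a profile to the gadgets: `a_v` and `b_v` play 1, `c_v` and `d_v` oppose `v`. -/
def extendToGadgets {V : Type*} (s : V → Bool) : V ⊕ (V × Fin 4) → Bool
  | .inl v => s v
  | .inr (v, i) => decide (i = 0 ∨ i = 1) || !s v

/-- Let `T` be non-flat (`T 0 = 1`) and let `T'` satisfy `T' 0 = 1`, `T' 1 = 0`
and `T' (k+2) = T k` for all `k`.  Then `G` admits a non-trivial PNE for `T` iff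
the graph obtained from `G` by attaching a fresh 4-cycle gadget to each vertex
admits a non-trivial PNE for `T'`. -/
theorem attachCycleGadgets_ntpne_iff {V : Type*} [Fintype V] (G : SimpleGraph V)
    (T T' : ℕ → Bool) (hT0 : T 0 = true)
    (h0 : T' 0 = true) (h1 : T' 1 = false) (hshift : ∀ k, T' (k + 2) = T k) :
    (∃ s : V → Bool, IsNTPNE G T s) ↔
      (∃ s' : V ⊕ (V × Fin 4) → Bool, IsNTPNE (attachCycleGadgets G) T' s') := by
  have h2 : T' 2 = true := (hshift 0).trans hT0
  have hT : (fun k => T' (k + 2)) = T := funext hshift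
  constructor
  · rintro ⟨s, hs, v, hv⟩
    refine ⟨extendToGadgets s, ?_, .inl v, hv⟩
    rintro (u | ⟨u, i⟩)
    · rw [bestResponds_inl (by simp [extendToGadgets]) (by simp [extendToGadgets]), hT]
      exact hs u
    · fin_cases i
      · refine bestResponds_inr_zero.2 ?_
        cases h : s u <;> simp [extendToGadgets, h, h2]
      · refine bestResponds_inr_one.2 ?_
        cases h : s u <;> simp [extendToGadgets, h, h2]
      · refine bestResponds_inr_two.2 ?_
        cases h : s u <;> simp [extendToGadgets, h, h1, h2]
      · refine bestResponds_inr_three.2 ?_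
        cases h : s u <;> simp [extendToGadgets, h, h1, h2]
  · rintro ⟨s, hs, w, -⟩
    have hpne : IsPNE G T (fun u => s (.inl u)) := fun v => by
      obtain ⟨ha, hb⟩ := gadget_attached_eq_true h0 h1 h2
        (bestResponds_inr_zero.1 (hs (.inr (v, 0)))) (bestResponds_inr_one.1 (hs (.inr (v, 1))))
        (bestResponds_inr_two.1 (hs (.inr (v, 2)))) (bestResponds_inr_three.1 (hs (.inr (v, 3))))
      rw [← hT]
      exact (bestResponds_inl ha hb).1 (hs (.inl v))
    refine ⟨fun u => s (.inl u), hpne, ?_⟩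
    by_contra! hne
    let v : V := w.elim id Prod.fst
    have hv := hpne v
    simp [BestResponds, hne, hT0] at hv
end

section
/- For every n ≥ 1, the path graph on n vertices admits a non-trivial pure Nash equilibrium for the Single-Neighbor pattern if and only if n ≡ 2 (mod 3). -/
/-- The profile on `Fin n` shifted to the positions `1, …, n` and extended by `false`. -/
def paddedProfile {n : ℕ} (s : Fin n → Bool) (k : ℕ) : Bool :=
  if h : 1 ≤ k ∧ k - 1 < n then s ⟨k - 1, h.2⟩ else false

lemma paddedProfile_succ {n : ℕ} (s : Fin n → Bool) (u : Fin n) :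
    paddedProfile s (u + 1) = s u := by
  simp [paddedProfile]

lemma paddedProfile_eq_true_iff {n : ℕ} (s : Fin n → Bool) (k : ℕ) :
    paddedProfile s k = true ↔ ∃ w : Fin n, (w : ℕ) + 1 = k ∧ s w = true := by
  constructor
  · intro h
    unfold paddedProfile at h
    split_ifs at h with hk
    exact ⟨⟨k - 1, hk.2⟩, by simp only; omega, h⟩
  · rintro ⟨w, rfl, hw⟩
    rwa [paddedProfile_succ]

lemma bestResponds_pathGraph_SN_iff {n : ℕ} (s : Fin n → Bool) (u : Fin n) :
    BestResponds (SimpleGraph.pathGraph n) SN s u ↔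
      paddedProfile s (u + 1) = (paddedProfile s u ^^ paddedProfile s (u + 2)) := by
  rw [paddedProfile_succ]
  unfold BestResponds
  suffices h : SN (Set.ncard {w | (SimpleGraph.pathGraph n).Adj u w ∧ s w = true}) =
      (paddedProfile s u ^^ paddedProfile s (u + 2)) by rw [h]
  have hl := paddedProfile_eq_true_iff s u
  have hr := paddedProfile_eq_true_iff s (u + 2)
  simp only [SimpleGraph.pathGraph_adj]
  by_cases h₁ : paddedProfile s u = true <;> by_cases h₂ : paddedProfile s (u + 2) = true
  · obtain ⟨a, ha, hsa⟩ := hl.1 h₁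
    obtain ⟨b, hb, hsb⟩ := hr.1 h₂
    have hab : a ≠ b := by rintro rfl; omega
    have : {w : Fin n | ((u : ℕ) + 1 = w ∨ (w : ℕ) + 1 = u) ∧ s w = true} = {a, b} := by
      ext w; simp only [Set.mem_ofPred_eq, Set.mem_insert_iff, Set.mem_singleton_iff]; grind
    rw [this, Set.ncard_pair hab, h₁, h₂]
    rfl
  · obtain ⟨a, ha, hsa⟩ := hl.1 h₁
    have : {w : Fin n | ((u : ℕ) + 1 = w ∨ (w : ℕ) + 1 = u) ∧ s w = true} = {a} := by
      ext w; simp only [Set.mem_ofPred_eq, Set.mem_singleton_iff]; grind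
    rw [this, Set.ncard_singleton, h₁, Bool.eq_false_of_not_eq_true h₂]
    rfl
  · obtain ⟨b, hb, hsb⟩ := hr.1 h₂
    have : {w : Fin n | ((u : ℕ) + 1 = w ∨ (w : ℕ) + 1 = u) ∧ s w = true} = {b} := by
      ext w; simp only [Set.mem_ofPred_eq, Set.mem_singleton_iff]; grind
    rw [this, Set.ncard_singleton, h₂, Bool.eq_false_of_not_eq_true h₁]
    rfl
  · have : {w : Fin n | ((u : ℕ) + 1 = w ∨ (w : ℕ) + 1 = u) ∧ s w = true} = ∅ := by
      ext w; simp only [Set.mem_ofPred_eq, Set.mem_empty_iff_false]; grind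
    rw [this, Set.ncard_empty, Bool.eq_false_of_not_eq_true h₁, Bool.eq_false_of_not_eq_true h₂]
    rfl

/-- A Boolean sequence starting with `false` in which each term is the xor of its two neighbors
is determined by its second term, and has period 3. -/
lemma eq_of_xor_recurrence {n : ℕ} {t : ℕ → Bool} (h0 : t 0 = false)
    (h : ∀ i < n, t (i + 1) = (t i ^^ t (i + 2))) (k : ℕ) (hk : k ≤ n + 1) :
    t k = (decide (k % 3 ≠ 0) && t 1) := by
  induction k using Nat.strong_induction_on with
  | _ k ih =>
    match k with
    | 0 => simp [h0]
    | 1 => simp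
    | k + 2 =>
      have hrec := h k (by omega)
      rw [ih k (by omega) (by omega), ih (k + 1) (by omega) (by omega)] at hrec
      have hmod : k % 3 = 0 ∨ k % 3 = 1 ∨ k % 3 = 2 := by omega
      rcases hmod with hm | hm | hm <;> cases h1 : t 1 <;> cases h2 : t (k + 2) <;>
        simp [Nat.add_mod, hm, h1, h2] at hrec ⊢

/-- For every `n ≥ 1`, the path graph on `n` vertices admits a non-trivial pure
Nash equilibrium for the Single-Neighbor pattern iff `n ≡ 2 (mod 3)`. -/
theorem pathGraph_ntpne_iff (n : ℕ) (hn : 1 ≤ n) :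
    (∃ s : Fin n → Bool, IsNTPNE (SimpleGraph.pathGraph n) SN s) ↔ n % 3 = 2 := by
  constructor
  · rintro ⟨s, hs, v, hv⟩
    have hrec : ∀ i < n, paddedProfile s (i + 1) =
        (paddedProfile s i ^^ paddedProfile s (i + 2)) :=
      fun i hi => (bestResponds_pathGraph_SN_iff s ⟨i, hi⟩).1 (hs ⟨i, hi⟩)
    have hper := eq_of_xor_recurrence (by simp [paddedProfile]) hrec
    have hend := hper (n + 1) le_rfl
    have hlast : paddedProfile s (n + 1) = false := by simp [paddedProfile]
    have hvt := hper (v + 1) (by omega)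
    rw [paddedProfile_succ, hv] at hvt
    have h1 : paddedProfile s 1 = true :=
      (Bool.and_eq_true_iff.1 hvt.symm).2
    rw [hlast, h1] at hend
    have : (n + 1) % 3 = 0 := by simpa using hend
    omega
  · intro hmod
    refine ⟨fun u => decide ((u.val + 1) % 3 ≠ 0), fun u => ?_, ⟨0, hn⟩, by simp⟩
    rw [bestResponds_pathGraph_SN_iff]
    have ht : ∀ k ≤ n + 1, paddedProfile (fun u : Fin n => decide ((u.val + 1) % 3 ≠ 0)) k =
        decide (k % 3 ≠ 0) := by
      intro k hk
      rw [Bool.eq_iff_iff, paddedProfile_eq_true_iff]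
      simp only [decide_eq_true_eq]
      constructor
      · rintro ⟨w, rfl, hw⟩
        exact hw
      · intro hk3
        have hk' : k - 1 + 1 = k := by omega
        exact ⟨⟨k - 1, by omega⟩, hk', by rwa [hk']⟩
    rw [ht _ (by omega), ht _ (by omega), ht _ (by omega)]
    have : (u : ℕ) % 3 = 0 ∨ (u : ℕ) % 3 = 1 ∨ (u : ℕ) % 3 = 2 := by omega
    rcases this with h | h | h <;> simp [Nat.add_mod, h]
end

section
/- For every n ≥ 3, the cycle graph on n vertices admits a non-trivial pure Nash equilibrium for the Single-Neighbor pattern if and only if n ≡ 0 (mod 3). -/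
/-- On a cycle, the best response for the Single-Neighbor pattern is the exclusive or of the
strategies of the two neighbors. -/
theorem bestResponds_cycleGraph_SN_iff {m : ℕ} (s : Fin (m + 3) → Bool) (v : Fin (m + 3)) :
    BestResponds (SimpleGraph.cycleGraph (m + 3)) SN s v ↔
      s v = xor (s (v - 1)) (s (v + 1)) := by
  have hne : v - 1 ≠ v + 1 := by
    simp only [ne_eq, sub_eq_iff_eq_add, add_assoc v, left_eq_add]
    exact ne_of_beq_false rfl
  have hset : {w | (SimpleGraph.cycleGraph (m + 3)).Adj v w ∧ s w = true} =
      {w | (w = v - 1 ∨ w = v + 1) ∧ s w = true} := by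
    ext w
    have := Set.ext_iff.mp (SimpleGraph.cycleGraph_neighborSet (v := v)) w
    simp_all
  have hcard : SN {w | (w = v - 1 ∨ w = v + 1) ∧ s w = true}.ncard =
      xor (s (v - 1)) (s (v + 1)) := by
    cases ha : s (v - 1) <;> cases hb : s (v + 1)
    · rw [show {w | (w = v - 1 ∨ w = v + 1) ∧ s w = true} = ∅ by ext w; simp; grind]
      simp [SN]
    · rw [show {w | (w = v - 1 ∨ w = v + 1) ∧ s w = true} = {v + 1} by ext w; simp; grind]
      simp [SN]
    · rw [show {w | (w = v - 1 ∨ w = v + 1) ∧ s w = true} = {v - 1} by ext w; simp; grind]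
      simp [SN]
    · rw [show {w | (w = v - 1 ∨ w = v + 1) ∧ s w = true} = {v - 1, v + 1} by ext w; simp; grind,
        Set.ncard_pair hne]
      simp [SN]
  rw [BestResponds, hset, hcard]

/-- A Boolean sequence satisfying the Fibonacci recurrence modulo two and having a period not
divisible by three vanishes. -/
theorem eq_false_of_xor_recurrence {t : ℕ → Bool} {n : ℕ}
    (hrec : ∀ k, t (k + 2) = xor (t (k + 1)) (t k)) (hper : Function.Periodic t n)
    (hn : n % 3 ≠ 0) (k : ℕ) : t k = false := by
  have h3 : Function.Periodic t 3 := fun k => by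
    rw [hrec (k + 1), hrec k]
    cases t (k + 1) <;> cases t k <;> rfl
  have hmod (j : ℕ) : t (j + n % 3) = t j := by
    rw [← hper j, ← h3.map_mod_nat (j + n % 3), ← h3.map_mod_nat (j + n), Nat.add_mod_mod]
  have h0 := hrec k
  have h1 := hrec (k + 1)
  have h2 := hmod k
  have h4 := hmod (k + 1)
  have h5 := hmod (k + 2)
  have h6 := h3 k
  have h7 := h3 (k + 1)
  have : n % 3 = 1 ∨ n % 3 = 2 := by omega
  rcases this with h | h <;> rw [h] at h2 h4 h5 <;> simp only [add_assoc] at * <;> grind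

/-- For every `n ≥ 3`, the cycle graph on `n` vertices admits a non-trivial pure
Nash equilibrium for the Single-Neighbor pattern iff `n ≡ 0 (mod 3)`. -/
theorem cycleGraph_ntpne_iff (n : ℕ) (hn : 3 ≤ n) :
    (∃ s : Fin n → Bool, IsNTPNE (SimpleGraph.cycleGraph n) SN s) ↔ n % 3 = 0 := by
  obtain ⟨m, rfl⟩ := Nat.exists_eq_add_of_le' hn
  simp only [IsNTPNE, IsPNE, bestResponds_cycleGraph_SN_iff]
  constructor
  · rintro ⟨s, hs, v, hv⟩
    by_contra h
    have hrec (k : ℕ) : s (v + (k + 2) • 1) = xor (s (v + (k + 1) • 1)) (s (v + k • 1)) := by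
      have := hs (v + (k + 1) • 1)
      rw [show v + (k + 1) • 1 - 1 = v + k • 1 by rw [succ_nsmul]; abel,
        show v + (k + 1) • 1 + 1 = v + (k + 2) • 1 by rw [succ_nsmul _ (k + 1), add_assoc]] at this
      rw [this, Bool.xor_right_comm, Bool.xor_self, Bool.false_xor]
    have hper : Function.Periodic (fun k : ℕ => s (v + k • 1)) (m + 3) := fun k => by
      have hcard : (m + 3) • (1 : Fin (m + 3)) = 0 := by
        simpa using card_nsmul_eq_zero (x := (1 : Fin (m + 3)))
      change s (v + (k + (m + 3)) • 1) = s (v + k • 1)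
      rw [add_nsmul, hcard, add_zero]
    simpa [hv] using eq_false_of_xor_recurrence hrec hper h 0
  · intro h
    have hdvd : 3 ∣ m + 3 := Nat.dvd_of_mod_eq_zero h
    refine ⟨fun i => decide (i.val % 3 ≠ 2), fun v => ?_, 0, by simp⟩
    have hsub : (v - 1).val % 3 = (v.val + 2) % 3 := by
      rw [Fin.val_sub, Nat.mod_mod_of_dvd _ hdvd, Fin.val_one]
      omega
    have hadd : (v + 1).val % 3 = (v.val + 1) % 3 := by
      rw [Fin.val_add, Nat.mod_mod_of_dvd _ hdvd, Fin.val_one]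
    simp only [hsub, hadd]
    have : v.val % 3 = 0 ∨ v.val % 3 = 1 ∨ v.val % 3 = 2 := by omega
    rcases this with h | h | h <;> simp [Nat.add_mod, h]
end
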